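/- arXiv:1008.4180 — 2 statements merged into one kernel-verified Lean document; each statement's English description precedes it below -/
import Mathlib

section
/- For every δ > 0 there exists a constant c = c(δ) > 0 such that for every prime p, every primitive root g modulo p, and every integer N with 2 ≤ N < p^{1/2}, one has (1/p)·∑_{x=0}^{p−1} |∑_{n=1}^{N} e^{2πi x g^n / p}| ≥ c·N^{1/48 − δ}. -/
open Finset


/-- Number of representations of `l` as a difference of two elements of `A`. -/
def rr {G : Type*} [AddCommGroup G] [DecidableEq G] (A : Finset G) (l : G) : ℕ :=
  #{x ∈ A | x - l ∈ A}

section additive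
variable {G : Type*} [AddCommGroup G] [Fintype G] [DecidableEq G]

theorem rr_neg (A : Finset G) (l : G) : rr A (-l) = rr A l := by
  unfold rr
  refine card_bij (fun x _ => x + l) ?_ ?_ ?_
  · intro x hx
    simp only [mem_filter, sub_neg_eq_add] at hx
    simp [hx.1, hx.2]
  · intro x _ y _ h
    simpa using h
  · intro y hy
    simp only [mem_filter] at hy
    exact ⟨y - l, by simp [hy.1, hy.2], by simp⟩

theorem count_shift (A : Finset G) (x y : G) :
    #{l : G | x - l ∈ A ∧ y - l ∈ A} = rr A (x - y) := by
  unfold rr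
  refine card_bij (fun l _ => x - l) ?_ ?_ ?_
  · intro l hl
    simp only [mem_filter, mem_univ, true_and] at hl
    simp only [mem_filter, hl.1, true_and]
    have : x - l - (x - y) = y - l := by abel
    rw [this]; exact hl.2
  · intro a _ b _ h
    simpa using h
  · intro z hz
    simp only [mem_filter] at hz
    refine ⟨x - z, ?_, by simp⟩
    simp only [mem_filter, mem_univ, true_and, sub_sub_cancel, hz.1]
    have : y - (x - z) = z - (x - y) := by abel
    rw [this]; exact hz.2

theorem sum_rr (A : Finset G) : ∑ l, rr A l = #A ^ 2 := by
  unfold rr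
  simp_rw [card_filter]
  rw [sum_comm]
  have : ∀ x ∈ A, ∑ l : G, (if x - l ∈ A then 1 else 0) = #A := by
    intro x _
    rw [← card_filter]
    refine card_bij (fun l _ => x - l) ?_ ?_ ?_
    · intro l hl; simpa using hl
    · intro a _ b _ h; simpa using h
    · intro z hz; exact ⟨x - z, by simpa using hz, by simp⟩
  rw [sum_congr rfl this]; simp [sq]

/-- Summing pair counts over the sets `A ∩ (A + l)`. -/
theorem sum_pairs (A : Finset G) (P : G → Prop) [DecidablePred P] :
    ∑ l : G, #{z ∈ {x ∈ A | x - l ∈ A} ×ˢ {x ∈ A | x - l ∈ A} | P (z.1 - z.2)} =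
      ∑ z ∈ (A ×ˢ A) with P (z.1 - z.2), rr A (z.1 - z.2) := by
  simp_rw [← count_shift A, card_filter]
  rw [sum_comm]
  refine sum_congr rfl fun l _ => ?_
  rw [← card_filter, ← card_filter]
  congr 1
  ext z
  simp only [mem_filter, mem_product]
  tauto

theorem select_B (A : Finset G) (κ : ℝ) (hκ : 0 < κ)
    (hA : A.Nonempty)
    (hE : (∑ l, (rr A l : ℝ) ^ 2) = κ * (#A : ℝ) ^ 2) :
    ∃ B ⊆ A, κ / 4 < #B ∧
      24 * (#{z ∈ B ×ˢ B | ¬ (κ / 48 ≤ (rr A (z.1 - z.2) : ℝ))} : ℝ) ≤ (#B : ℝ) ^ 2 := by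
  classical
  set P : G → Prop := fun l => ¬ (κ / 48 ≤ (rr A l : ℝ)) with hP
  set bad : G → ℕ := fun l =>
    #{z ∈ {x ∈ A | x - l ∈ A} ×ˢ {x ∈ A | x - l ∈ A} | P (z.1 - z.2)} with hbad
  have hN : (0 : ℝ) < (#A : ℝ) := by exact_mod_cast hA.card_pos
  have h1 : (∑ l, (bad l : ℝ)) ≤ κ / 48 * (#A : ℝ) ^ 2 := by
    have := sum_pairs A P
    have h2 : (∑ l, (bad l : ℝ)) =
        ∑ z ∈ (A ×ˢ A) with P (z.1 - z.2), (rr A (z.1 - z.2) : ℝ) := by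
      exact_mod_cast this
    rw [h2]
    calc _ ≤ ∑ z ∈ (A ×ˢ A) with P (z.1 - z.2), κ / 48 := by
            refine sum_le_sum fun z hz => ?_
            simp only [mem_filter, hP, not_le] at hz
            exact hz.2.le
      _ ≤ ∑ z ∈ (A ×ˢ A), κ / 48 :=
            sum_le_sum_of_subset_of_nonneg (filter_subset _ _) (fun _ _ _ => by positivity)
      _ = _ := by simp [card_product]; ring
  have h3 : (∑ l, (rr A l : ℝ)) = (#A : ℝ) ^ 2 := by exact_mod_cast sum_rr A
  have h4 : 0 < ∑ l : G, ((rr A l : ℝ) ^ 2 - 24 * bad l - κ / 4 * rr A l) := by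
    rw [sum_sub_distrib, sum_sub_distrib, ← mul_sum, ← mul_sum, hE, h3]
    have : 0 < κ * (#A : ℝ) ^ 2 := by positivity
    linarith
  obtain ⟨l, _, hl⟩ := exists_lt_of_sum_lt (s := (univ : Finset G)) (f := fun _ => (0 : ℝ))
    (g := fun l => ((rr A l : ℝ) ^ 2 - 24 * bad l - κ / 4 * rr A l)) (by simpa using h4)
  refine ⟨{x ∈ A | x - l ∈ A}, filter_subset _ _, ?_, ?_⟩
  · change κ / 4 < (rr A l : ℝ)
    have hb : (0 : ℝ) ≤ bad l := by positivity
    have hr : (0 : ℝ) ≤ rr A l := by positivity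
    by_contra hcon
    push Not at hcon
    nlinarith
  · change 24 * (bad l : ℝ) ≤ (rr A l : ℝ) ^ 2
    have hr : (0 : ℝ) ≤ rr A l := by positivity
    have : 0 ≤ κ / 4 * rr A l := by positivity
    linarith

/-- Markov inequality for a bipartite relation. -/
theorem markov_rel {α : Type*} [DecidableEq α] (X Y : Finset α) (Q : α → α → Prop) [DecidableRel Q]
    (t s : ℝ) (ht : 0 < t)
    (h : (#{z ∈ X ×ˢ Y | Q z.1 z.2} : ℝ) ≤ s * t) :
    (#{x ∈ X | ¬ ((#{y ∈ Y | Q x y} : ℝ) ≤ t)} : ℝ) ≤ s := by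
  have h1 : (#{z ∈ X ×ˢ Y | Q z.1 z.2} : ℝ) = ∑ x ∈ X, (#{y ∈ Y | Q x y} : ℝ) := by
    simp_rw [card_filter]
    rw [sum_product]
    push_cast
    rfl
  have h2 : (#{x ∈ X | ¬ ((#{y ∈ Y | Q x y} : ℝ) ≤ t)} : ℝ) * t ≤
      ∑ x ∈ X, (#{y ∈ Y | Q x y} : ℝ) := by
    calc _ = ∑ x ∈ X with ¬ ((#{y ∈ Y | Q x y} : ℝ) ≤ t), t := by simp
      _ ≤ ∑ x ∈ X with ¬ ((#{y ∈ Y | Q x y} : ℝ) ≤ t), (#{y ∈ Y | Q x y} : ℝ) := by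
        refine sum_le_sum fun x hx => ?_
        simp only [mem_filter, not_le] at hx
        exact hx.2.le
      _ ≤ _ := sum_le_sum_of_subset_of_nonneg (filter_subset _ _)
        (fun _ _ _ => Nat.cast_nonneg _)
  rw [h1] at h
  exact le_of_mul_le_mul_right (h2.trans h) ht

theorem select_V (B : Finset G) (R : G → Prop) [DecidablePred R] (hR : ∀ x, R (-x) ↔ R x)
    (θ : ℝ) (hB : B.Nonempty)
    (hbad : 24 * (#{z ∈ B ×ˢ B | ¬ R (z.1 - z.2)} : ℝ) ≤ (#B : ℝ) ^ 2) (hθ0 : 0 ≤ θ)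
    (hθ : 24 * (θ * #{x : G | R x}) ≤ (#B : ℝ) ^ 2) :
    ∃ V ⊆ B, (#B : ℝ) / 2 ≤ #V ∧ ∀ c ∈ V, ∀ d ∈ V, ∀ w ∈ V,
      (#B : ℝ) / 2 * ((#B : ℝ) / 2 * θ) ≤
        #{z ∈ B ×ˢ B ×ˢ B | R (c - z.1) ∧ R (w - z.2.1) ∧ R (z.1 - z.2.2) ∧
          z.2.2 + z.2.1 - d ∈ B} := by
  classical
  set b : ℝ := (#B : ℝ) with hb
  have hb0 : 0 < b := by rw [hb]; exact_mod_cast hB.card_pos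
  set V0 : Finset G := {x ∈ B | (#{y ∈ B | ¬ R (x - y)} : ℝ) ≤ b / 4} with hV0
  have hV0B : V0 ⊆ B := filter_subset _ _
  have c0 : (#{x ∈ B | ¬ ((#{y ∈ B | ¬ R (x - y)} : ℝ) ≤ b / 4)} : ℝ) ≤ b / 6 :=
    markov_rel B B (fun x y => ¬ R (x - y)) (b / 4) (b / 6) (by positivity) (by
      have : b / 6 * (b / 4) = b ^ 2 / 24 := by ring
      rw [this]; linarith)
  have c0' : (#V0 : ℝ) + #{x ∈ B | ¬ ((#{y ∈ B | ¬ R (x - y)} : ℝ) ≤ b / 4)} = b := by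
    rw [hb]; exact_mod_cast card_filter_add_card_filter_not (s := B) _
  set n : G → ℕ := fun δ => #{y ∈ V0 | y + δ ∈ B} with hn
  -- few bad pairs
  have c1 : (#{z ∈ V0 ×ˢ B | (n (z.2 - z.1) : ℝ) < θ} : ℝ) ≤ b / 3 * (b / 4) := by
    have e1 : #{z ∈ V0 ×ˢ B | (n (z.2 - z.1) : ℝ) < θ} ≤
        #{z ∈ B ×ˢ B | ¬ R (z.1 - z.2)} +
        #{z ∈ V0 ×ˢ B | R (z.2 - z.1) ∧ (n (z.2 - z.1) : ℝ) < θ} := by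
      rw [← card_filter_add_card_filter_not (s := {z ∈ V0 ×ˢ B | (n (z.2 - z.1) : ℝ) < θ})
        (fun z => ¬ R (z.1 - z.2))]
      refine Nat.add_le_add (card_le_card ?_) (card_le_card ?_)
      · intro z hz
        simp only [mem_filter, mem_product] at hz ⊢
        exact ⟨⟨hV0B hz.1.1.1, hz.1.1.2⟩, hz.2⟩
      · intro z hz
        simp only [mem_filter, mem_product, not_not] at hz ⊢
        refine ⟨hz.1.1, ?_, hz.1.2⟩
        rw [← hR]; simpa using hz.2
    have e2 : (#{z ∈ V0 ×ˢ B | R (z.2 - z.1) ∧ (n (z.2 - z.1) : ℝ) < θ} : ℝ) ≤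
        θ * #{x : G | R x} := by
      have : #{z ∈ V0 ×ˢ B | R (z.2 - z.1) ∧ (n (z.2 - z.1) : ℝ) < θ} =
          ∑ δ ∈ {x : G | R x ∧ (n x : ℝ) < θ},
            #{z ∈ {z ∈ V0 ×ˢ B | R (z.2 - z.1) ∧ (n (z.2 - z.1) : ℝ) < θ} | z.2 - z.1 = δ} := by
        refine card_eq_sum_card_fiberwise (f := fun z : G × G => z.2 - z.1) ?_
        intro z hz
        simp only [coe_filter, Set.mem_ofPred_eq, mem_univ, true_and] at hz ⊢
        exact hz.2
      rw [this]
      push_cast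
      calc _ ≤ ∑ δ ∈ {x : G | R x ∧ (n x : ℝ) < θ}, θ := by
            refine sum_le_sum fun δ hδ => ?_
            simp only [mem_filter, mem_univ, true_and] at hδ
            refine le_trans ?_ hδ.2.le
            norm_cast
            refine card_le_card_of_injOn (fun z => z.1) ?_ ?_
            · intro z hz
              simp only [coe_filter, mem_filter, mem_product, Set.mem_ofPred_eq] at hz ⊢
              refine ⟨hz.1.1.1, ?_⟩
              rw [← hz.2]; simpa using hz.1.1.2
            · intro z hz z' hz' h
              simp only [coe_filter, mem_filter, mem_product, Set.mem_ofPred_eq] at hz hz' h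
              have := hz.2.trans hz'.2.symm
              rw [h] at this
              exact Prod.ext h (by simpa using this)
        _ ≤ ∑ δ ∈ {x : G | R x}, θ := by
            refine sum_le_sum_of_subset_of_nonneg ?_ (fun _ _ _ => hθ0)
            intro x hx
            simp only [mem_filter, mem_univ, true_and] at hx ⊢
            exact hx.1
        _ = _ := by simp [mul_comm]
    have e1' : (#{z ∈ V0 ×ˢ B | (n (z.2 - z.1) : ℝ) < θ} : ℝ) ≤
        #{z ∈ B ×ˢ B | ¬ R (z.1 - z.2)} +
        #{z ∈ V0 ×ˢ B | R (z.2 - z.1) ∧ (n (z.2 - z.1) : ℝ) < θ} := by exact_mod_cast e1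
    have : b / 3 * (b / 4) = b ^ 2 / 12 := by ring
    rw [this]; linarith
  set V : Finset G := {d ∈ V0 | (#{f ∈ B | (n (f - d) : ℝ) < θ} : ℝ) ≤ b / 4} with hV
  have c2 := markov_rel V0 B (fun d f => (n (f - d) : ℝ) < θ) (b / 4) (b / 3) (by positivity) c1
  have c2' : (#V : ℝ) + #{d ∈ V0 | ¬ ((#{f ∈ B | (n (f - d) : ℝ) < θ} : ℝ) ≤ b / 4)} = #V0 := by
    exact_mod_cast card_filter_add_card_filter_not (s := V0) _
  have hVV0 : V ⊆ V0 := filter_subset _ _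
  refine ⟨V, hVV0.trans hV0B, by linarith, ?_⟩
  intro c hc d hd w hw
  -- two sets missing at most a quarter each
  have two : ∀ (S T : G → Prop) [DecidablePred S] [DecidablePred T],
      (#{x ∈ B | ¬ S x} : ℝ) ≤ b / 4 → (#{x ∈ B | ¬ T x} : ℝ) ≤ b / 4 →
      b / 2 ≤ #{x ∈ B | S x ∧ T x} := by
    intro S T _ _ hS hT
    have h1 : #B ≤ #{x ∈ B | S x ∧ T x} + (#{x ∈ B | ¬ S x} + #{x ∈ B | ¬ T x}) := by
      rw [← card_filter_add_card_filter_not (s := B) (fun x => S x ∧ T x)]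
      refine Nat.add_le_add_left ?_ _
      refine le_trans (card_le_card ?_) (card_union_le _ _)
      intro x hx
      simp only [mem_filter, mem_union] at hx ⊢
      tauto
    have h1' : b ≤ #{x ∈ B | S x ∧ T x} + ((#{x ∈ B | ¬ S x} : ℝ) + #{x ∈ B | ¬ T x}) := by
      rw [hb]; exact_mod_cast h1
    linarith
  have hcq : ∀ c ∈ V0, (#{y ∈ B | ¬ R (c - y)} : ℝ) ≤ b / 4 := fun c hc =>
    (mem_filter.1 hc).2
  have hf : b / 2 ≤ #{f ∈ B | R (w - f) ∧ ¬ (n (f - d) : ℝ) < θ} := by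
    refine two _ _ (hcq w (hVV0 hw)) ?_
    simp only [not_not]
    exact (mem_filter.1 hd).2
  have hsum : #{z ∈ B ×ˢ B ×ˢ B | R (c - z.1) ∧ R (w - z.2.1) ∧ R (z.1 - z.2.2) ∧
          z.2.2 + z.2.1 - d ∈ B} =
        ∑ f ∈ B, ∑ y ∈ B, #{e ∈ B | R (c - e) ∧ R (w - f) ∧ R (e - y) ∧ y + f - d ∈ B} := by
    simp_rw [card_filter, sum_product]
    rw [sum_comm]
    refine sum_congr rfl fun f _ => ?_
    rw [sum_comm]
  rw [hsum]
  push_cast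
  calc b / 2 * (b / 2 * θ) ≤ #{f ∈ B | R (w - f) ∧ ¬ (n (f - d) : ℝ) < θ} * (b / 2 * θ) := by
        gcongr
    _ = ∑ f ∈ B with (R (w - f) ∧ ¬ (n (f - d) : ℝ) < θ), (b / 2 * θ) := by rw [sum_const, nsmul_eq_mul]
    _ ≤ ∑ f ∈ B with (R (w - f) ∧ ¬ (n (f - d) : ℝ) < θ), ∑ y ∈ B,
          (#{e ∈ B | R (c - e) ∧ R (w - f) ∧ R (e - y) ∧ y + f - d ∈ B} : ℝ) := by
        refine sum_le_sum fun f hf => ?_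
        simp only [mem_filter, not_lt] at hf
        calc b / 2 * θ ≤ b / 2 * n (f - d) := by gcongr; exact hf.2.2
          _ = ∑ y ∈ V0 with y + (f - d) ∈ B, b / 2 := by rw [sum_const, nsmul_eq_mul, mul_comm]
          _ ≤ ∑ y ∈ V0 with y + (f - d) ∈ B,
              (#{e ∈ B | R (c - e) ∧ R (w - f) ∧ R (e - y) ∧ y + f - d ∈ B} : ℝ) := by
            refine sum_le_sum fun y hy => ?_
            simp only [mem_filter] at hy
            have := two (fun e => R (c - e)) (fun e => R (y - e)) (hcq c (hVV0 hc)) (hcq y hy.1)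
            refine this.trans ?_
            norm_cast
            refine card_le_card ?_
            intro e he
            simp only [mem_filter] at he ⊢
            refine ⟨he.1, he.2.1, hf.2.1, ?_, ?_⟩
            · rw [← hR]; simpa using he.2.2
            · rw [add_sub_assoc]; exact hy.2
          _ ≤ _ := by
            refine sum_le_sum_of_subset_of_nonneg ((filter_subset _ _).trans hV0B)
              (fun _ _ _ => Nat.cast_nonneg _)
    _ ≤ _ := sum_le_sum_of_subset_of_nonneg (filter_subset _ _)
        (fun _ _ _ => sum_nonneg fun _ _ => Nat.cast_nonneg _)

/-- Number of representations as `x₁-y₁+x₂-y₂+x₃-y₃+x₄`. -/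
def F3 (A : Finset G) (s : G) : ℕ :=
  ∑ α : G, ∑ β : G, ∑ γ : G, if s - α - β - γ ∈ A then rr A α * rr A β * rr A γ else 0

theorem sum_F3 (A : Finset G) : ∑ s, F3 A s = #A ^ 7 := by
  unfold F3
  rw [sum_comm]
  have key : ∀ α β γ : G, ∑ s : G, (if s - α - β - γ ∈ A then rr A α * rr A β * rr A γ else 0) =
      #A * (rr A α * rr A β * rr A γ) := by
    intro α β γ
    rw [← sum_filter, sum_const, smul_eq_mul]
    congr 1
    refine card_bij (fun s _ => s - α - β - γ) ?_ ?_ ?_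
    · intro l hl; simpa using hl
    · intro a _ b _ h; simpa using h
    · intro z hz; exact ⟨z + γ + β + α, by simpa using hz, by simp⟩
  have : ∀ α : G, ∑ s : G, ∑ β : G, ∑ γ : G,
      (if s - α - β - γ ∈ A then rr A α * rr A β * rr A γ else 0) = #A ^ 5 * rr A α := by
    intro α
    rw [sum_comm]
    have : ∀ β : G, ∑ s : G, ∑ γ : G,
      (if s - α - β - γ ∈ A then rr A α * rr A β * rr A γ else 0) = #A ^ 3 * rr A α * rr A β := by
      intro β
      rw [sum_comm, sum_congr rfl fun γ _ => key α β γ]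
      rw [← mul_sum, ← mul_sum, sum_rr]
      ring
    rw [sum_congr rfl fun β _ => this β, ← mul_sum, sum_rr]
    ring
  rw [sum_congr rfl fun α _ => this α, ← mul_sum, sum_rr]
  ring

theorem F3_lower (A B : Finset G) (hBA : B ⊆ A) (t : ℝ) (ht : 0 ≤ t) (c d w : G) :
    t ^ 3 * #{z ∈ B ×ˢ B ×ˢ B | t ≤ (rr A (c - z.1) : ℝ) ∧ t ≤ (rr A (w - z.2.1) : ℝ) ∧
      t ≤ (rr A (z.1 - z.2.2) : ℝ) ∧ z.2.2 + z.2.1 - d ∈ B} ≤ (F3 A (c - d + w) : ℝ) := by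
  classical
  set S := {z ∈ B ×ˢ B ×ˢ B | t ≤ (rr A (c - z.1) : ℝ) ∧ t ≤ (rr A (w - z.2.1) : ℝ) ∧
      t ≤ (rr A (z.1 - z.2.2) : ℝ) ∧ z.2.2 + z.2.1 - d ∈ B} with hS
  set Φ : G × G × G → ℝ := fun q => if c - d + w - q.1 - q.2.1 - q.2.2 ∈ A then
    (rr A q.1 : ℝ) * rr A q.2.1 * rr A q.2.2 else 0 with hΦ
  have h1 : (F3 A (c - d + w) : ℝ) = ∑ q : G × G × G, Φ q := by
    unfold F3
    rw [Fintype.sum_prod_type]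
    simp_rw [Fintype.sum_prod_type]
    push_cast
    rfl
  set ι : G × G × G → G × G × G := fun z => (c - z.1, w - z.2.1, z.1 - z.2.2) with hι
  have hinj : Set.InjOn ι S := by
    rintro ⟨e, f, y⟩ _ ⟨e', f', y'⟩ _ h
    simp only [hι, Prod.mk.injEq, sub_right_inj] at h
    obtain ⟨h1, h2, h3⟩ := h
    subst h1; subst h2
    simp at h3
    simp [h3]
  calc t ^ 3 * #S = ∑ z ∈ S, t ^ 3 := by simp [mul_comm]
    _ ≤ ∑ z ∈ S, Φ (ι z) := by
      refine sum_le_sum fun z hz => ?_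
      simp only [hS, mem_filter, mem_product] at hz
      have hm : c - d + w - (c - z.1) - (w - z.2.1) - (z.1 - z.2.2) ∈ A := by
        have : c - d + w - (c - z.1) - (w - z.2.1) - (z.1 - z.2.2) = z.2.2 + z.2.1 - d := by abel
        rw [this]; exact hBA hz.2.2.2.2
      simp only [hΦ, hι, hm, if_true]
      have a1 := hz.2.1
      have a2 := hz.2.2.1
      have a3 := hz.2.2.2.1
      calc t ^ 3 = t * t * t := by ring
        _ ≤ _ := by gcongr
    _ = ∑ q ∈ S.image ι, Φ q := (sum_image hinj).symm
    _ ≤ ∑ q, Φ q := by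
      refine sum_le_sum_of_subset_of_nonneg (subset_univ _) (fun q _ _ => ?_)
      simp only [hΦ]; split_ifs <;> positivity
    _ = _ := h1.symm

theorem core (A : Finset G) (κ : ℝ) (hκ : 0 < κ) (hA : A.Nonempty)
    (hE : (∑ l, (rr A l : ℝ) ^ 2) = κ * (#A : ℝ) ^ 2) :
    ∃ V ⊆ A, κ / 8 ≤ #V ∧ ∀ c ∈ V, ∀ d ∈ V, ∀ w ∈ V,
      κ ^ 8 / (48 ^ 3 * 64 * 18432 * (#A : ℝ) ^ 2) ≤ F3 A (c - d + w) := by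
  classical
  obtain ⟨B, hBA, hb, hbad⟩ := select_B A κ hκ hA hE
  have hN : (0 : ℝ) < (#A : ℝ) := by exact_mod_cast hA.card_pos
  have hb0 : (0 : ℝ) < #B := by linarith
  have hBne : B.Nonempty := by
    rw [← card_pos]; exact_mod_cast hb0
  have hP : κ / 48 * (#{x : G | κ / 48 ≤ (rr A x : ℝ)} : ℝ) ≤ (#A : ℝ) ^ 2 := by
    have h3 : (∑ l, (rr A l : ℝ)) = (#A : ℝ) ^ 2 := by exact_mod_cast sum_rr A
    rw [← h3]
    calc _ = ∑ x ∈ {x : G | κ / 48 ≤ (rr A x : ℝ)}, κ / 48 := by simp [mul_comm]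
      _ ≤ ∑ x ∈ {x : G | κ / 48 ≤ (rr A x : ℝ)}, (rr A x : ℝ) :=
        sum_le_sum fun x hx => (mem_filter.1 hx).2
      _ ≤ _ := sum_le_sum_of_subset_of_nonneg (subset_univ _) (fun _ _ _ => by positivity)
  obtain ⟨V, hVB, hV, h⟩ := select_V B (fun l => κ / 48 ≤ (rr A l : ℝ))
    (fun x => by simp only [rr_neg]) (κ ^ 3 / (18432 * (#A : ℝ) ^ 2)) hBne hbad (by positivity) (by
      have e : κ ^ 3 / (18432 * (#A : ℝ) ^ 2) * (#{x : G | κ / 48 ≤ (rr A x : ℝ)} : ℝ) =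
        κ ^ 2 / (384 * (#A : ℝ) ^ 2) * (κ / 48 * (#{x : G | κ / 48 ≤ (rr A x : ℝ)} : ℝ)) := by
        field_simp; ring
      rw [e]
      calc _ ≤ 24 * (κ ^ 2 / (384 * (#A : ℝ) ^ 2) * (#A : ℝ) ^ 2) := by gcongr
        _ = (κ / 4) ^ 2 := by field_simp; norm_num
        _ ≤ _ := by gcongr)
  refine ⟨V, hVB.trans hBA, by linarith, fun c hc d hd w hw => ?_⟩
  have h5 := F3_lower A B hBA (κ / 48) (by positivity) c d w
  refine le_trans ?_ h5
  have h6 := h c hc d hd w hw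
  calc _ = (κ / 48) ^ 3 * (κ / 4 / 2 * (κ / 4 / 2 * (κ ^ 3 / (18432 * (#A : ℝ) ^ 2)))) := by
        field_simp; norm_num
    _ ≤ (κ / 48) ^ 3 * ((#B : ℝ) / 2 * ((#B : ℝ) / 2 * (κ ^ 3 / (18432 * (#A : ℝ) ^ 2)))) := by
        gcongr
    _ ≤ _ := by gcongr

end additive

theorem cs_collision {α β : Type*} [DecidableEq α] [DecidableEq β] (X : Finset α) (T : Finset β)
    (φ : α → β) (h : ∀ x ∈ X, φ x ∈ T) :
    #X ^ 2 ≤ #T * #{z ∈ X ×ˢ X | φ z.1 = φ z.2} := by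
  have h1 : #X = ∑ t ∈ T, #{x ∈ X | φ x = t} := card_eq_sum_card_fiberwise h
  have h2 : #{z ∈ X ×ˢ X | φ z.1 = φ z.2} = ∑ t ∈ T, #{x ∈ X | φ x = t} ^ 2 := by
    rw [card_eq_sum_card_fiberwise (f := fun z => φ z.1) (t := T)]
    · refine sum_congr rfl fun t _ => ?_
      rw [sq, ← card_product]
      congr 1
      ext ⟨a, b⟩
      simp only [mem_filter, mem_product]
      constructor
      · rintro ⟨⟨⟨h1, h2⟩, h3⟩, h4⟩
        exact ⟨⟨h1, h4⟩, h2, h3 ▸ h4⟩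
      · rintro ⟨⟨h1, h4⟩, h2, h3⟩
        exact ⟨⟨⟨h1, h2⟩, h4.trans h3.symm⟩, h4⟩
    · intro z hz
      simp only [coe_filter, mem_product, Set.mem_ofPred_eq] at hz
      exact h _ hz.1.1
  rw [h1, h2]
  exact sq_sum_le_card_mul_sum_sq

def CC (U : Finset ℕ) (j : ℕ) : ℕ :=
  #{z ∈ (U ×ˢ U) ×ˢ (U ×ˢ U) | z.1.1 + z.1.2 = j + (z.2.1 + z.2.2)}

theorem shift_lemma (N : ℕ) (U : Finset ℕ) (hU : U ⊆ Icc 1 N) (h7 : 7 ≤ #U) :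
    ∃ j, 1 ≤ j ∧ j ≤ N ∧ j * #U ≤ 6 * N ∧ #U ^ 4 ≤ 6 * N * CC U j := by
  classical
  set u := #U with hu
  have huN : u ≤ N := by simpa using card_le_card hU
  obtain ⟨J, hJ1, hJ2, hJ0⟩ : ∃ J, 6 * N ≤ J * u ∧ (J - 1) * u ≤ 6 * N ∧ 1 ≤ J := by
    refine ⟨6 * N / u + 1, ?_, ?_, Nat.le_add_left _ _⟩
    · have := Nat.div_add_mod (6 * N) u
      have := Nat.mod_lt (6 * N) (show 0 < u by omega)
      nlinarith
    · simpa using Nat.div_mul_le_self _ _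
  by_contra hcon
  push Not at hcon
  have hJN : J - 1 ≤ N := by
    by_contra h
    push Not at h
    nlinarith
  have hC : ∀ j, 1 ≤ j → j < J → 6 * N * CC U j < u ^ 4 := by
    intro j h1 h2
    refine hcon j h1 (by omega) ?_
    refine le_trans (Nat.mul_le_mul_right _ ?_) hJ2
    omega
  set X := range J ×ˢ (U ×ˢ U) with hX
  have hcard : #X = J * u ^ 2 := by simp [hX, sq, hu]
  have hJ3 : J ≤ N + 1 := by omega
  have hcs := cs_collision X (Icc 1 (3 * N)) (fun z => z.1 + (z.2.1 + z.2.2)) (by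
    rintro ⟨i, a, b⟩ hz
    simp only [hX, mem_product, mem_range] at hz
    have ha := hU hz.2.1
    have hb := hU hz.2.2
    simp only [mem_Icc] at ha hb ⊢
    omega)
  -- collisions
  set K : ℕ → ℕ → ℕ := fun i i' =>
    #{z ∈ (U ×ˢ U) ×ˢ (U ×ˢ U) | i + (z.1.1 + z.1.2) = i' + (z.2.1 + z.2.2)} with hK
  have hcol : #{z ∈ X ×ˢ X | z.1.1 + (z.1.2.1 + z.1.2.2) = z.2.1 + (z.2.2.1 + z.2.2.2)} =
      ∑ i ∈ range J, ∑ i' ∈ range J, K i i' := by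
    simp_rw [hK, hX, card_filter]
    rw [sum_product, sum_product]
    refine sum_congr rfl fun i _ => ?_
    simp_rw [sum_product (range J) (U ×ˢ U)]
    rw [sum_comm]
    refine sum_congr rfl fun i' _ => ?_
    rw [sum_product (U ×ˢ U) (U ×ˢ U)]
  have hdiag : ∀ i, K i i ≤ u ^ 3 := by
    intro i
    have : u ^ 3 = #(U ×ˢ (U ×ˢ U)) := by simp [pow_succ, hu, mul_assoc]
    rw [this]
    refine card_le_card_of_injOn (fun z => (z.1.1, z.2)) ?_ ?_
    · intro z hz
      simp only [coe_filter, mem_product, Set.mem_ofPred_eq, coe_product, Set.mem_prod, mem_coe] at hz ⊢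
      exact ⟨hz.1.1.1, hz.1.2⟩
    · rintro ⟨⟨a, b⟩, c, d⟩ hz ⟨⟨a', b'⟩, c', d'⟩ hz' h
      simp only [coe_filter, mem_product, Set.mem_ofPred_eq, Prod.mk.injEq] at hz hz' h ⊢
      omega
  have hlt : ∀ i i', i < i' → K i i' = CC U (i' - i) := by
    intro i i' h
    simp only [hK, CC]
    congr 1
    refine filter_congr fun z _ => ?_
    omega
  have hsymm : ∀ i i', K i i' = K i' i := by
    intro i i'
    simp only [hK]
    refine card_bij (fun z _ => (z.2, z.1)) ?_ ?_ ?_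
    · intro z hz
      simp only [mem_filter, mem_product] at hz ⊢
      exact ⟨⟨hz.1.2, hz.1.1⟩, hz.2.symm⟩
    · rintro ⟨a, b⟩ _ ⟨c, d⟩ _ h
      simp at h ⊢; tauto
    · rintro ⟨a, b⟩ hz
      simp only [mem_filter, mem_product] at hz 
      refine ⟨(b, a), ?_, rfl⟩
      simp only [mem_filter, mem_product]
      exact ⟨⟨hz.1.2, hz.1.1⟩, hz.2.symm⟩
  have hoff : ∀ i < J, ∀ i' < J, i ≠ i' → 6 * N * K i i' ≤ u ^ 4 := by
    intro i hi i' hi' hne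
    rcases lt_or_gt_of_ne hne with h | h
    · rw [hlt _ _ h]; exact (hC _ (by omega) (by omega)).le
    · rw [hsymm, hlt _ _ h]; exact (hC _ (by omega) (by omega)).le
  have hrow : ∀ i ∈ range J, 6 * N * ∑ i' ∈ range J, K i i' ≤ 6 * N * u ^ 3 + (J - 1) * u ^ 4 := by
    intro i hi
    rw [← add_sum_erase _ _ hi, mul_add, mul_sum]
    refine Nat.add_le_add (Nat.mul_le_mul_left _ (hdiag i)) ?_
    calc _ ≤ ∑ x ∈ (range J).erase i, u ^ 4 := by
          refine sum_le_sum fun x hx => ?_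
          simp only [mem_erase, mem_range] at hx hi
          exact hoff _ hi _ hx.2 hx.1.symm
      _ = _ := by simp [card_erase_of_mem hi]
  have htot : 6 * N * ∑ i ∈ range J, ∑ i' ∈ range J, K i i' ≤
      J * (6 * N * u ^ 3 + (J - 1) * u ^ 4) := by
    rw [mul_sum]
    calc _ ≤ ∑ x ∈ range J, (6 * N * u ^ 3 + (J - 1) * u ^ 4) := sum_le_sum hrow
      _ = _ := by simp
  rw [hcard, hcol] at hcs
  simp only [Nat.card_Icc, add_tsub_cancel_right] at hcs
  have h8 : 2 * (J * u ^ 2) ^ 2 ≤ J * (6 * N * u ^ 3 + (J - 1) * u ^ 4) := by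
    refine le_trans ?_ htot
    nlinarith
  obtain ⟨J', rfl⟩ : ∃ J', J = J' + 1 := ⟨J - 1, by omega⟩
  simp only [add_tsub_cancel_right] at *
  have h9 : 2 * (J' + 1) * u ^ 4 ≤ 6 * N * u ^ 3 + J' * u ^ 4 := by
    refine le_of_mul_le_mul_left (a := J' + 1) ?_ (Nat.succ_pos _)
    calc _ = 2 * ((J' + 1) * u ^ 2) ^ 2 := by ring
      _ ≤ _ := h8
  have h10 : 6 * N * u ^ 3 ≤ (J' + 1) * u ^ 4 := by
    calc _ ≤ ((J' + 1) * u) * u ^ 3 := Nat.mul_le_mul_right _ hJ1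
      _ = _ := by ring
  have h11 : 0 < u ^ 4 := by positivity
  nlinarith

section field
variable {F : Type*} [Field F] [Fintype F] [DecidableEq F]

theorem rr_dil (A A' : Finset F) (q : F) (hq : q ≠ 0) (h : ∀ a ∈ A, q * a ∈ A') (l : F) :
    rr A l ≤ rr A' (q * l) := by
  unfold rr
  refine card_le_card_of_injOn (fun x => q * x) ?_ ?_
  · intro x hx
    simp only [coe_filter, Set.mem_ofPred_eq] at hx ⊢
    refine ⟨h _ hx.1, ?_⟩
    rw [← mul_sub]; exact h _ hx.2
  · intro x _ y _ hxy
    exact mul_left_cancel₀ hq hxy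

theorem F3_dil (A A' : Finset F) (q : F) (hq : q ≠ 0) (h : ∀ a ∈ A, q * a ∈ A') (s : F) :
    F3 A s ≤ F3 A' (q * s) := by
  have re : ∀ f : F → ℕ, ∑ x, f x = ∑ x, f (q * x) := fun f =>
    (Equiv.sum_comp (Equiv.mulLeft₀ q hq) f).symm
  unfold F3
  refine le_of_le_of_eq ?_ (re _).symm
  refine sum_le_sum fun α _ => ?_
  refine le_of_le_of_eq ?_ (re _).symm
  refine sum_le_sum fun β _ => ?_
  refine le_of_le_of_eq ?_ (re _).symm
  refine sum_le_sum fun γ _ => ?_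
  beta_reduce
  split_ifs with h1 h2
  · gcongr <;> exact rr_dil A A' q hq h _
  · exact absurd (by rw [← mul_sub, ← mul_sub, ← mul_sub]; exact h _ h1) h2
  · exact Nat.zero_le _
  · exact Nat.zero_le _

/-- Energy of the map sending a pair (v, w) to α v - β w. -/
def En (V : Finset F) (α β : F) : ℕ :=
  #{z ∈ (V ×ˢ V) ×ˢ (V ×ˢ V) | α * z.1.1 - β * z.1.2 = α * z.2.1 - β * z.2.2}

theorem En_scale (V : Finset F) (α β q : F) (hq : q ≠ 0) :
    En V (q * α) (q * β) = En V α β := by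
  unfold En
  congr 1
  refine filter_congr fun z _ => ?_
  rw [mul_assoc, mul_assoc, mul_assoc, mul_assoc, ← mul_sub, ← mul_sub, mul_right_inj' hq]

theorem En_inj (V : Finset F) (α β : F)
    (h : ∀ v ∈ V, ∀ v' ∈ V, ∀ w ∈ V, ∀ w' ∈ V, α * v - β * v' = α * w - β * w' → v = w ∧ v' = w') :
    En V α β ≤ #V ^ 2 := by
  unfold En
  have : #V ^ 2 = #(V ×ˢ V) := by simp [sq]
  rw [this]
  refine card_le_card_of_injOn (fun z => z.1) ?_ ?_
  · intro z hz
    simp only [coe_filter, Set.mem_ofPred_eq, mem_product] at hz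
    simp [hz.1.1]
  · rintro ⟨⟨a, b⟩, c, d⟩ hz ⟨⟨a', b'⟩, c', d'⟩ hz' hh
    simp only [coe_filter, Set.mem_ofPred_eq, mem_product, Prod.mk.injEq] at hz hz' hh ⊢
    obtain ⟨h1, h2⟩ := h a hz.1.1.1 b hz.1.1.2 c hz.1.2.1 d hz.1.2.2 hz.2
    obtain ⟨h3, h4⟩ := h a' hz'.1.1.1 b' hz'.1.1.2 c' hz'.1.2.1 d' hz'.1.2.2 hz'.2
    obtain ⟨h5, h6⟩ := hh
    subst h1 h2 h3 h4 h5 h6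
    simp

theorem En_avg (V : Finset F) (h : F) (h0 : h ≠ 0) (hV : #V ^ 2 ≤ orderOf h) (hV0 : V.Nonempty) :
    ∃ i, En V 1 (h ^ (i + 1)) ≤ 2 * #V ^ 2 := by
  by_contra hcon
  push Not at hcon
  set o := orderOf h with ho
  have hinj : Set.InjOn (fun i => h ^ (i + 1)) (range o) := by
    intro i hi j hj hij
    simp only [coe_range, Set.mem_Iio] at hi hj
    simp only [pow_succ] at hij
    exact pow_injOn_Iio_orderOf hi hj (mul_right_cancel₀ h0 hij)
  have hpos : 0 < #V := hV0.card_pos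
  -- upper bound for the sum
  have hsum : ∑ i ∈ range o, En V 1 (h ^ (i + 1)) ≤ o * #V ^ 2 + #V ^ 4 := by
    set P := (V ×ˢ V) ×ˢ (V ×ˢ V) with hP
    have e1 : ∑ i ∈ range o, En V 1 (h ^ (i + 1)) =
        ∑ z ∈ P, #{i ∈ range o | 1 * z.1.1 - h ^ (i + 1) * z.1.2 = 1 * z.2.1 - h ^ (i + 1) * z.2.2} := by
      simp only [En, card_filter]
      rw [sum_comm]
    have e2 : ∀ z ∈ P, #{i ∈ range o | 1 * z.1.1 - h ^ (i + 1) * z.1.2 =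
        1 * z.2.1 - h ^ (i + 1) * z.2.2} ≤ (if z.1 = z.2 then o else 0) + 1 := by
      rintro ⟨⟨a, b⟩, c, d⟩ _
      simp only [Prod.mk.injEq]
      split_ifs with hz
      · refine le_trans (card_filter_le _ _) (by simp)
      · rw [zero_add, card_le_one]
        intro i hi j hj
        simp only [mem_filter, one_mul] at hi hj
        refine hinj (by simpa using hi.1) (by simpa using hj.1) ?_
        have hbd : b ≠ d := by
          rintro rfl
          apply hz
          have := hi.2
          simp at this
          exact ⟨this, rfl⟩
        have : (h ^ (i + 1) - h ^ (j + 1)) * (b - d) = 0 := by linear_combination hj.2 - hi.2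
        rcases mul_eq_zero.1 this with h1 | h1
        · exact sub_eq_zero.1 h1
        · exact absurd (sub_eq_zero.1 h1) hbd
    rw [e1]
    refine (sum_le_sum e2).trans ?_
    rw [sum_add_distrib, sum_const, smul_eq_mul, mul_one, ← sum_filter, sum_const, smul_eq_mul]
    refine Nat.add_le_add ?_ ?_
    · rw [mul_comm]
      refine Nat.mul_le_mul_left _ ?_
      have : #V ^ 2 = #(V ×ˢ V) := by simp [sq]
      rw [this]
      refine card_le_card_of_injOn (fun z => z.1) ?_ ?_
      · intro z hz
        simp only [hP, coe_filter, Set.mem_ofPred_eq, mem_product] at hz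
        simp [hz.1.1]
      · rintro ⟨a, b⟩ hz ⟨a', b'⟩ hz' hh
        simp only [hP, coe_filter, Set.mem_ofPred_eq, mem_product] at hz hz' hh
        rw [← hz.2, ← hz'.2, hh]
    · simp [hP]; apply le_of_eq; ring
  have hlow : ∑ i ∈ range o, (2 * #V ^ 2 + 1) ≤ ∑ i ∈ range o, En V 1 (h ^ (i + 1)) :=
    sum_le_sum fun i _ => hcon i
  simp only [sum_const, card_range, smul_eq_mul] at hlow
  have h3 : #V ^ 4 ≤ o * #V ^ 2 := by
    calc #V ^ 4 = #V ^ 2 * #V ^ 2 := by ring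
      _ ≤ _ := Nat.mul_le_mul_right _ hV
  have h4 : 0 < o := lt_of_lt_of_le (by positivity) hV
  nlinarith

theorem pivot (V : Finset F) (hV2 : 2 ≤ #V) (h : F) (h0 : h ≠ 0) (hV : #V ^ 2 ≤ orderOf h) :
    ∃ a ∈ V, ∃ b ∈ V, ∃ c ∈ V, ∃ d ∈ V,
      En V (c - d) (h * (a - b)) ≤ 2 * #V ^ 2 := by
  set D : F → Prop := fun x => x ≠ 0 ∧ ∃ a ∈ V, ∃ b ∈ V, x = a - b with hD
  suffices hs : ∃ d1 d2, D d1 ∧ D d2 ∧ En V d1 (h * d2) ≤ 2 * #V ^ 2 by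
    obtain ⟨d1, d2, ⟨_, c, hc, d, hd, rfl⟩, ⟨_, a, ha, b, hb, rfl⟩, hE⟩ := hs
    exact ⟨a, ha, b, hb, c, hc, d, hd, hE⟩
  by_cases hA : ∃ d1 d2, D d1 ∧ D d2 ∧ ∀ e1 e2, D e1 → D e2 → d1 * e2 ≠ h * d2 * e1
  · obtain ⟨d1, d2, hd1, hd2, hne⟩ := hA
    refine ⟨d1, d2, hd1, hd2, (En_inj V _ _ ?_).trans (by omega)⟩
    intro v hv v' hv' w hw w' hw' he
    have he2 : d1 * (v - w) = h * d2 * (v' - w') := by linear_combination he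
    by_cases h1 : v' = w'
    · refine ⟨?_, h1⟩
      rw [h1, sub_self, mul_zero] at he2
      rcases mul_eq_zero.1 he2 with h2 | h2
      · exact absurd h2 hd1.1
      · exact sub_eq_zero.1 h2
    · have h3 : v - w ≠ 0 := by
        intro h4
        rw [h4, mul_zero] at he2
        exact mul_ne_zero (mul_ne_zero h0 hd2.1) (sub_ne_zero.2 h1) he2.symm
      exact absurd he2 (hne _ _ ⟨sub_ne_zero.2 h1, v', hv', w', hw', rfl⟩ ⟨h3, v, hv, w, hw, rfl⟩)
  · push Not at hA
    have hind : ∀ i : ℕ, ∃ d1 d2, D d1 ∧ D d2 ∧ d2 = h ^ i * d1 := by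
      intro i
      induction i with
      | zero =>
        obtain ⟨a, ha, b, hb, hab⟩ := one_lt_card.1 hV2
        have : D (a - b) := ⟨sub_ne_zero.2 hab, a, ha, b, hb, rfl⟩
        exact ⟨_, _, this, this, by simp⟩
      | succ i ih =>
        obtain ⟨d1, d2, h1, h2, he⟩ := ih
        obtain ⟨e1, e2, h3, h4, h5⟩ := hA d1 d2 h1 h2
        refine ⟨e1, e2, h3, h4, mul_left_cancel₀ h1.1 ?_⟩
        rw [h5, he]; ring
    obtain ⟨i, hi⟩ := En_avg V h h0 hV (card_pos.1 (by omega))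
    obtain ⟨d1, d2, h1, h2, he⟩ := hind i
    refine ⟨d1, d2, h1, h2, ?_⟩
    have := En_scale V 1 (h ^ (i + 1)) d1 h1.1
    rw [← this] at hi
    convert hi using 2
    · ring
    · rw [he]; ring

end field

section field2
variable {F : Type*} [Field F] [Fintype F] [DecidableEq F]

theorem collision_bound (V : Finset F) (hV0 : ∀ v ∈ V, v ≠ 0) (h d1 d2 : F) (h0 : h ≠ 0)
    (M : Finset F) (hM1 : ∀ v ∈ V, ∀ w ∈ V, v * (d1 + w) ∈ M)
    (hM2 : ∀ v ∈ V, ∀ w ∈ V, h * v * (d2 + w) ∈ M) :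
    #{z ∈ (V ×ˢ V) ×ˢ (V ×ˢ V) | z.1.1 * z.1.2 = h * (z.2.1 * z.2.2)} ^ 2 ≤
      #M ^ 2 * (En V d1 (h * d2) * #V) := by
  set Ω := {z ∈ (V ×ˢ V) ×ˢ (V ×ˢ V) | z.1.1 * z.1.2 = h * (z.2.1 * z.2.2)} with hΩ
  have hcs := cs_collision Ω (M ×ˢ M)
    (fun z => (z.1.1 * (d1 + z.1.2), h * z.2.1 * (d2 + z.2.2))) (by
      intro z hz
      simp only [hΩ, mem_filter, mem_product] at hz ⊢
      exact ⟨hM1 _ hz.1.1.1 _ hz.1.1.2, hM2 _ hz.1.2.1 _ hz.1.2.2⟩)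
  refine hcs.trans ?_
  rw [card_product, ← sq]
  refine Nat.mul_le_mul_left _ ?_
  unfold En
  rw [← card_product]
  refine card_le_card_of_injOn
    (fun z => (((z.1.1.1, z.1.2.1), (z.2.1.1, z.2.2.1)), z.1.1.2)) ?_ ?_
  · rintro ⟨⟨⟨v, w⟩, v', w'⟩, ⟨v1, w1⟩, v1', w1'⟩ hz
    simp only [hΩ, coe_filter, mem_filter, Set.mem_ofPred_eq, mem_product, Prod.mk.injEq,
      coe_product, Set.mem_prod, mem_coe] at hz ⊢
    obtain ⟨⟨⟨⟨⟨a1, a2⟩, a3, a4⟩, a5⟩, ⟨⟨a6, a7⟩, a8, a9⟩, a10⟩, a11, a12⟩ := hz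
    refine ⟨⟨⟨⟨a1, a3⟩, a6, a8⟩, ?_⟩, a2⟩
    linear_combination a11 - a12 - a5 + a10
  · rintro ⟨⟨⟨v, w⟩, v', w'⟩, ⟨v1, w1⟩, v1', w1'⟩ hz ⟨⟨⟨x, y⟩, x', y'⟩, ⟨x1, y1⟩, x1', y1'⟩ hz2 heq
    simp only [hΩ, coe_filter, mem_filter, Set.mem_ofPred_eq, mem_product, Prod.mk.injEq]
      at hz hz2 heq ⊢
    obtain ⟨⟨⟨⟨⟨a1, a2⟩, a3, a4⟩, a5⟩, ⟨⟨a6, a7⟩, a8, a9⟩, a10⟩, a11, a12⟩ := hz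
    obtain ⟨⟨⟨_, b5⟩, ⟨_, b10⟩⟩, b11, b12⟩ := hz2
    obtain ⟨⟨⟨rfl, rfl⟩, rfl, rfl⟩, rfl⟩ := heq
    have e1 : w' = y' := by
      refine mul_left_cancel₀ (mul_ne_zero h0 (hV0 _ a3)) ?_
      linear_combination b5 - a5
    have e2 : w1 = y1 := by
      refine mul_left_cancel₀ (hV0 _ a6) ?_
      linear_combination b11 - a11
    subst e1
    have e3 : w1' = y1' := by
      refine mul_left_cancel₀ (mul_ne_zero h0 (hV0 _ a8)) ?_
      linear_combination b12 - a12
    simp [e2, e3]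

theorem card_M (A : Finset F) (T : ℝ) :
    (#{s : F | T ≤ (F3 A s : ℝ)} : ℝ) * T ≤ (#A : ℝ) ^ 7 := by
  have h := sum_F3 A
  have h' : (∑ s, (F3 A s : ℝ)) = (#A : ℝ) ^ 7 := by exact_mod_cast h
  rw [← h']
  calc _ = ∑ s ∈ {s : F | T ≤ (F3 A s : ℝ)}, T := by rw [sum_const, nsmul_eq_mul]
    _ ≤ ∑ s ∈ {s : F | T ≤ (F3 A s : ℝ)}, (F3 A s : ℝ) :=
      sum_le_sum fun x hx => (mem_filter.1 hx).2
    _ ≤ _ := sum_le_sum_of_subset_of_nonneg (subset_univ _) (fun _ _ _ => Nat.cast_nonneg _)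

theorem order_bound (g : F) (N j u : ℕ) (hN : N ^ 2 ≤ orderOf g) (hN0 : 0 < N) (hj : 1 ≤ j)
    (hju : j * u ≤ 6 * N) (hu : 6 * u ≤ N) : u ^ 2 ≤ orderOf (g ^ j) := by
  have hg : 0 < orderOf g := lt_of_lt_of_le (by positivity) hN
  have hf : IsOfFinOrder g := orderOf_pos_iff.1 hg
  have ho : 0 < orderOf (g ^ j) := orderOf_pos_iff.2 hf.pow
  have hd : orderOf g ∣ j * orderOf (g ^ j) := by
    apply orderOf_dvd_of_pow_eq_one
    rw [pow_mul, pow_orderOf_eq_one]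
  have hle := Nat.le_of_dvd (by positivity) hd
  refine le_of_mul_le_mul_left (a := j) ?_ hj
  calc j * u ^ 2 = j * u * u := by ring
    _ ≤ 6 * N * u := Nat.mul_le_mul_right _ hju
    _ = N * (6 * u) := by ring
    _ ≤ N * N := Nat.mul_le_mul_left _ hu
    _ = N ^ 2 := by ring
    _ ≤ _ := hN.trans hle

theorem final_arith (κ N u m K : ℝ) (hκ : 0 < κ) (hN : 0 < N) (hm : 0 ≤ m) (hK : 0 < K)
    (hu : κ / 100 ≤ u) (f5 : u ^ 5 ≤ 72 * N ^ 2 * m ^ 2)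
    (f4 : m * (κ ^ 8 / (K * N ^ 2)) ≤ (3 * N) ^ 7) :
    κ ^ 21 ≤ (700 ^ 21 + 100 ^ 5 * 72 * 3 ^ 14 * K ^ 2) * N ^ 20 := by
  have f6 : m * κ ^ 8 ≤ 3 ^ 7 * K * N ^ 9 := by
    have : m * κ ^ 8 = m * (κ ^ 8 / (K * N ^ 2)) * (K * N ^ 2) := by
      field_simp
    rw [this]
    calc _ ≤ (3 * N) ^ 7 * (K * N ^ 2) := mul_le_mul_of_nonneg_right f4 (by positivity)
      _ = _ := by ring
  calc κ ^ 21 = 100 ^ 5 * (κ / 100) ^ 5 * (κ ^ 8) ^ 2 := by ring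
    _ ≤ 100 ^ 5 * u ^ 5 * (κ ^ 8) ^ 2 := by gcongr
    _ ≤ 100 ^ 5 * (72 * N ^ 2 * m ^ 2) * (κ ^ 8) ^ 2 := by gcongr
    _ = 100 ^ 5 * (72 * N ^ 2) * (m * κ ^ 8) ^ 2 := by ring
    _ ≤ 100 ^ 5 * (72 * N ^ 2) * (3 ^ 7 * K * N ^ 9) ^ 2 := by
      refine mul_le_mul_of_nonneg_left ?_ (by positivity)
      exact pow_le_pow_left₀ (by positivity) f6 2
    _ = (100 ^ 5 * 72 * 3 ^ 14 * K ^ 2) * N ^ 20 := by ring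
    _ ≤ _ := by
      refine mul_le_mul_of_nonneg_right ?_ (by positivity)
      exact le_add_of_nonneg_left (by positivity)

theorem energy_bound (g : F) (N : ℕ) (hN0 : 0 < N) (hN : N ^ 2 ≤ orderOf g) (κ : ℝ) (hκ : 0 < κ)
    (hE : (∑ l, (rr ((Icc 1 N).image (fun n => g ^ n)) l : ℝ) ^ 2) = κ * (N : ℝ) ^ 2) :
    κ ^ 21 ≤ (700 ^ 21 + 100 ^ 5 * 72 * 3 ^ 14 * (48 ^ 3 * 64 * 18432) ^ 2) * (N : ℝ) ^ 20 := by
  have hN1 : (1 : ℝ) ≤ N := by exact_mod_cast hN0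
  rcases lt_or_ge κ 700 with hsmall | hbig
  · calc κ ^ 21 ≤ 700 ^ 21 := by gcongr
      _ ≤ 700 ^ 21 * (N : ℝ) ^ 20 := le_mul_of_one_le_right (by positivity) (one_le_pow₀ hN1)
      _ ≤ _ := by
        refine mul_le_mul_of_nonneg_right ?_ (by positivity)
        exact le_add_of_nonneg_right (by positivity)
  have hg0 : g ≠ 0 := by
    rintro rfl
    have : orderOf (0 : F) = 0 := by
      rw [orderOf_eq_zero_iff']
      intro n hn
      simp [hn.ne']
    rw [this] at hN
    have : 0 < N ^ 2 := by positivity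
    omega
  have hNo : N ≤ orderOf g := le_trans (by nlinarith) hN
  have hinj : Set.InjOn (fun n => g ^ n) (Icc 1 N : Finset ℕ) := by
    intro i hi j hj hij
    simp only [coe_Icc, Set.mem_Icc] at hi hj
    have hi' : i - 1 < orderOf g := by omega
    have hj' : j - 1 < orderOf g := by omega
    have : g ^ (i - 1) = g ^ (j - 1) := by
      refine mul_right_cancel₀ hg0 ?_
      rw [← pow_succ, ← pow_succ]
      rw [Nat.sub_add_cancel hi.1, Nat.sub_add_cancel hj.1]
      exact hij
    have := pow_injOn_Iio_orderOf hi' hj' this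
    omega
  set A := (Icc 1 N).image (fun n => g ^ n) with hA
  have hAc : #A = N := by rw [hA, card_image_of_injOn hinj]; simp
  have hAne : A.Nonempty := card_pos.1 (by omega)
  have hκN : κ ≤ N := by
    have h1 : (∑ l, (rr A l : ℝ)) = (N : ℝ) ^ 2 := by
      rw [← hAc]; exact_mod_cast sum_rr A
    have h2 : (∑ l, (rr A l : ℝ) ^ 2) ≤ ∑ l, (N : ℝ) * rr A l := by
      refine sum_le_sum fun l _ => ?_
      have : (rr A l : ℝ) ≤ N := by
        rw [← hAc]; exact_mod_cast card_filter_le _ _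
      rw [sq]; gcongr
    rw [← mul_sum, h1, hE] at h2
    exact le_of_mul_le_mul_right h2 (by positivity)
  obtain ⟨V0, hV0A, hV0c, hcore⟩ := core A κ hκ hAne (by rw [hE, hAc])
  obtain ⟨K, hK⟩ : ∃ K : ℝ, K = 48 ^ 3 * 64 * 18432 := ⟨_, rfl⟩
  have hKpos : 0 < K := by rw [hK]; norm_num
  rw [← hK]
  rw [← hK] at hcore
  set u := ⌈κ / 100⌉₊ with hu
  have hu1 : κ / 100 ≤ u := Nat.le_ceil _
  have hu2 : (u : ℝ) < κ / 100 + 1 := Nat.ceil_lt_add_one (by positivity)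
  obtain ⟨V, hVV0, hVu⟩ := exists_subset_card_eq (s := V0) (n := u) (by
    have : (u : ℝ) ≤ #V0 := by linarith
    exact_mod_cast this)
  have hu7 : 7 ≤ u := by
    have : (7 : ℝ) ≤ u := by linarith
    exact_mod_cast this
  have hu6 : 6 * u ≤ N := by
    have : (6 : ℝ) * u ≤ N := by linarith
    exact_mod_cast this
  set U := {n ∈ Icc 1 N | g ^ n ∈ V} with hU
  have hUN : U ⊆ Icc 1 N := filter_subset _ _
  have hVU : V = U.image (fun n => g ^ n) := by
    ext x
    simp only [mem_image, hU, mem_filter]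
    constructor
    · intro hx
      obtain ⟨n, hn, rfl⟩ := mem_image.1 (hV0A (hVV0 hx))
      exact ⟨n, ⟨hn, hx⟩, rfl⟩
    · rintro ⟨n, ⟨_, h⟩, rfl⟩
      exact h
  have hinjU : Set.InjOn (fun n => g ^ n) (U : Set ℕ) := hinj.mono (by exact_mod_cast hUN)
  have hUu : #U = u := by rw [← hVu, hVU, card_image_of_injOn hinjU]
  obtain ⟨j, hj1, hjN, hju, hjC⟩ := shift_lemma N U hUN (by omega)
  rw [hUu] at hju hjC
  set h := g ^ j with hh
  have h0 : h ≠ 0 := pow_ne_zero _ hg0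
  have hord : u ^ 2 ≤ orderOf h := order_bound g N j u hN hN0 hj1 hju hu6
  obtain ⟨a, ha, b, hb, c, hc, d, hd, hEn⟩ := pivot V (by omega) h h0 (by rw [hVu]; exact hord)
  set A' := (Icc 1 (3 * N)).image (fun n => g ^ n) with hA'
  have hA'c : #A' ≤ 3 * N := by
    refine card_image_le.trans (by simp)
  set T : ℝ := κ ^ 8 / (K * (N : ℝ) ^ 2) with hT
  have hVne : ∀ v ∈ V, v ≠ 0 := by
    intro v hv
    rw [hVU] at hv
    obtain ⟨n, _, rfl⟩ := mem_image.1 hv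
    exact pow_ne_zero _ hg0
  set M : Finset F := {s : F | T ≤ (F3 A' s : ℝ)} with hM
  have hTpos : 0 < T := by positivity
  have hlow : ∀ c ∈ V, ∀ d ∈ V, ∀ w ∈ V, T ≤ F3 A (c - d + w) := by
    intro c hc d hd w hw
    have := hcore c (hVV0 hc) d (hVV0 hd) w (hVV0 hw)
    rw [hAc] at this
    exact this
  have hM1 : ∀ v ∈ V, ∀ w ∈ V, v * (c - d + w) ∈ M := by
    intro v hv w hw
    simp only [hM, mem_filter, mem_univ, true_and]
    refine (hlow c hc d hd w hw).trans ?_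
    norm_cast
    refine F3_dil A A' v (hVne v hv) ?_ _
    intro x hx
    obtain ⟨n, hn, rfl⟩ := mem_image.1 (hV0A (hVV0 hv))
    obtain ⟨m, hm, rfl⟩ := mem_image.1 hx
    simp only [mem_Icc] at hn hm
    refine mem_image.2 ⟨n + m, ?_, pow_add _ _ _⟩
    simp only [mem_Icc]; omega
  have hM2 : ∀ v ∈ V, ∀ w ∈ V, h * v * (a - b + w) ∈ M := by
    intro v hv w hw
    simp only [hM, mem_filter, mem_univ, true_and]
    refine (hlow a ha b hb w hw).trans ?_
    norm_cast
    refine F3_dil A A' (h * v) (mul_ne_zero h0 (hVne v hv)) ?_ _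
    intro x hx
    obtain ⟨n, hn, rfl⟩ := mem_image.1 (hV0A (hVV0 hv))
    obtain ⟨m, hm, rfl⟩ := mem_image.1 hx
    simp only [mem_Icc] at hn hm
    refine mem_image.2 ⟨j + n + m, ?_, ?_⟩
    · simp only [mem_Icc]; omega
    · simp only [hh, pow_add]
  have hcol := collision_bound V hVne h (c - d) (a - b) h0 M hM1 hM2
  set ω := #{z ∈ (V ×ˢ V) ×ˢ (V ×ˢ V) | z.1.1 * z.1.2 = h * (z.2.1 * z.2.2)} with hω
  have hCω : CC U j ≤ ω := by
    rw [CC, hω]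
    refine card_le_card_of_injOn
      (fun z => ((g ^ z.1.1, g ^ z.1.2), (g ^ z.2.1, g ^ z.2.2))) ?_ ?_
    · rintro ⟨⟨x, y⟩, z, w⟩ hz
      simp only [coe_filter, Set.mem_ofPred_eq, mem_product] at hz ⊢
      obtain ⟨⟨⟨h1, h2⟩, h3, h4⟩, h5⟩ := hz
      refine ⟨⟨⟨(mem_filter.1 h1).2, (mem_filter.1 h2).2⟩, (mem_filter.1 h3).2,
        (mem_filter.1 h4).2⟩, ?_⟩
      rw [hh, ← pow_add, ← pow_add, ← pow_add, h5]
    · rintro ⟨⟨x, y⟩, z, w⟩ hz ⟨⟨x', y'⟩, z', w'⟩ hz' he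
      simp only [coe_filter, Set.mem_ofPred_eq, mem_product, Prod.mk.injEq] at hz hz' he ⊢
      obtain ⟨⟨⟨h1, h2⟩, h3, h4⟩, h5⟩ := hz
      obtain ⟨⟨⟨h1', h2'⟩, h3', h4'⟩, h5'⟩ := hz'
      exact ⟨⟨hinjU h1 h1' he.1.1, hinjU h2 h2' he.1.2⟩, hinjU h3 h3' he.2.1, hinjU h4 h4' he.2.2⟩
  rw [hVu] at hcol hEn
  have f1 : u ^ 4 ≤ 6 * N * ω := hjC.trans (Nat.mul_le_mul_left _ hCω)
  have f2 : ω ^ 2 ≤ #M ^ 2 * (2 * u ^ 3) := by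
    refine hcol.trans (Nat.mul_le_mul_left _ ?_)
    calc _ ≤ 2 * u ^ 2 * u := Nat.mul_le_mul_right _ hEn
      _ = _ := by ring
  have f3 : u ^ 5 ≤ 72 * N ^ 2 * #M ^ 2 := by
    refine le_of_mul_le_mul_left (a := u ^ 3) ?_ (by positivity)
    calc u ^ 3 * u ^ 5 = (u ^ 4) ^ 2 := by ring
      _ ≤ (6 * N * ω) ^ 2 := Nat.pow_le_pow_left f1 2
      _ = 36 * N ^ 2 * ω ^ 2 := by ring
      _ ≤ 36 * N ^ 2 * (#M ^ 2 * (2 * u ^ 3)) := Nat.mul_le_mul_left _ f2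
      _ = _ := by ring
  have f4 : (#M : ℝ) * T ≤ (3 * N : ℝ) ^ 7 := by
    refine (card_M A' T).trans ?_
    have : (#A' : ℝ) ≤ 3 * N := by exact_mod_cast hA'c
    exact pow_le_pow_left₀ (Nat.cast_nonneg _) this 7
  have f5 : (u : ℝ) ^ 5 ≤ 72 * (N : ℝ) ^ 2 * (#M : ℝ) ^ 2 := by exact_mod_cast f3
  exact final_arith κ N u (#M) K hκ (by linarith) (Nat.cast_nonneg _) hKpos hu1 f5 f4

end field2

section analytic
variable {p : ℕ} [Fact p.Prime]

theorem parseval (c : ZMod p → ℝ) :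
    ∑ x : ZMod p, ‖∑ l : ZMod p, (c l : ℂ) * ZMod.stdAddChar (x * l)‖ ^ 2 =
      p * ∑ l, c l ^ 2 := by
  have hψ := ZMod.isPrimitive_stdAddChar p
  apply Complex.ofReal_injective
  push_cast
  have h1 : ∀ x : ZMod p, ((‖∑ l : ZMod p, (c l : ℂ) * ZMod.stdAddChar (x * l)‖ : ℂ)) ^ 2 =
      ∑ l : ZMod p, ∑ m : ZMod p, (c l : ℂ) * c m * ZMod.stdAddChar (x * (l - m)) := by
    intro x
    rw [← Complex.mul_conj', map_sum, sum_mul_sum]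
    refine sum_congr rfl fun l _ => sum_congr rfl fun m _ => ?_
    rw [map_mul (starRingEnd ℂ), Complex.conj_ofReal, ← AddChar.map_neg_eq_conj, mul_sub, sub_eq_add_neg,
      AddChar.map_add_eq_mul]
    ring
  rw [sum_congr rfl fun x _ => h1 x, sum_comm, mul_sum]
  refine sum_congr rfl fun l _ => ?_
  rw [sum_comm]
  have h2 : ∀ m : ZMod p, ∑ x : ZMod p, (c l : ℂ) * c m * ZMod.stdAddChar (x * (l - m)) =
      if m = l then (p : ℂ) * (c l : ℂ) ^ 2 else 0 := by
    intro m
    rw [← mul_sum, AddChar.sum_mulShift _ hψ]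
    by_cases h : m = l
    · subst h; simp [ZMod.card]; ring
    · have : l - m ≠ 0 := sub_ne_zero.2 (Ne.symm h)
      simp [h, this]
  rw [sum_congr rfl fun m _ => h2 m]
  simp

theorem normsq_f (A : Finset (ZMod p)) (x : ZMod p) :
    ((‖∑ a ∈ A, (ZMod.stdAddChar (x * a) : ℂ)‖ ^ 2 : ℝ) : ℂ) =
      ∑ l : ZMod p, ((rr A l : ℝ) : ℂ) * ZMod.stdAddChar (x * l) := by
  push_cast
  rw [← Complex.mul_conj', map_sum, sum_mul_sum]
  have h : ∀ l : ZMod p, (rr A l : ℂ) * ZMod.stdAddChar (x * l) =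
      ∑ a ∈ A, if a - l ∈ A then (ZMod.stdAddChar (x * l) : ℂ) else 0 := by
    intro l
    rw [← sum_filter, sum_const, nsmul_eq_mul]; rfl
  rw [sum_congr rfl fun l _ => h l, sum_comm (s := (univ : Finset (ZMod p))) (t := A)]
  refine sum_congr rfl fun a _ => ?_
  rw [← Equiv.sum_comp (Equiv.subLeft a)]
  simp only [Equiv.subLeft_apply, sub_sub_cancel]
  rw [← sum_filter, filter_mem_eq_inter, univ_inter]
  refine sum_congr rfl fun b _ => ?_
  rw [← AddChar.map_neg_eq_conj, mul_sub, sub_eq_add_neg,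
      AddChar.map_add_eq_mul]

theorem holder3 {ι : Type*} (s : Finset ι) (f : ι → ℝ) (hf : ∀ i, 0 ≤ f i) :
    (∑ i ∈ s, f i ^ 2) ^ 3 ≤ (∑ i ∈ s, f i) ^ 2 * ∑ i ∈ s, f i ^ 4 := by
  set S1 := ∑ i ∈ s, f i
  set S2 := ∑ i ∈ s, f i ^ 2
  set S3 := ∑ i ∈ s, f i ^ 3
  set S4 := ∑ i ∈ s, f i ^ 4
  have p1 : 0 ≤ S1 := sum_nonneg fun i _ => hf i
  have p2 : 0 ≤ S2 := sum_nonneg fun i _ => by positivity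
  have p3 : 0 ≤ S3 := sum_nonneg fun i _ => pow_nonneg (hf i) 3
  have p4 : 0 ≤ S4 := sum_nonneg fun i _ => by positivity
  have a1 : S2 ^ 2 ≤ S1 * S3 :=
    sum_sq_le_sum_mul_sum_of_sq_le_mul s (fun i _ => hf i) (fun i _ => pow_nonneg (hf i) 3)
      (fun i _ => le_of_eq (by ring))
  have a2 : S3 ^ 2 ≤ S2 * S4 :=
    sum_sq_le_sum_mul_sum_of_sq_le_mul s (fun i _ => by positivity) (fun i _ => by positivity)
      (fun i _ => le_of_eq (by ring))
  rcases p2.eq_or_lt with h | h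
  · rw [← h]; simp; positivity
  refine le_of_mul_le_mul_left (a := S2) ?_ h
  calc S2 * S2 ^ 3 = (S2 ^ 2) ^ 2 := by ring
    _ ≤ (S1 * S3) ^ 2 := by gcongr
    _ = S1 ^ 2 * S3 ^ 2 := by ring
    _ ≤ S1 ^ 2 * (S2 * S4) := by gcongr
    _ = _ := by ring

theorem L1_lower (A : Finset (ZMod p)) (κ : ℝ) (hA : A.Nonempty)
    (hE : (∑ l, (rr A l : ℝ) ^ 2) = κ * (#A : ℝ) ^ 2) :
    (#A : ℝ) ≤ κ * ((1 / (p : ℝ)) * ∑ x : ZMod p, ‖∑ a ∈ A, (ZMod.stdAddChar (x * a) : ℂ)‖) ^ 2 := by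
  have hp : (0 : ℝ) < p := by exact_mod_cast (Fact.out : p.Prime).pos
  have hN : (0 : ℝ) < #A := by exact_mod_cast hA.card_pos
  have h2 : ∑ x : ZMod p, ‖∑ a ∈ A, (ZMod.stdAddChar (x * a) : ℂ)‖ ^ 2 = p * #A := by
    have := parseval (p := p) (fun l => if l ∈ A then 1 else 0)
    have e : ∀ x : ZMod p, ∑ l : ZMod p, (((if l ∈ A then 1 else 0 : ℝ)) : ℂ) *
        ZMod.stdAddChar (x * l) = ∑ a ∈ A, (ZMod.stdAddChar (x * a) : ℂ) := by
      intro x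
      rw [← sum_filter_add_sum_filter_not univ (fun l => l ∈ A), filter_mem_eq_inter, univ_inter]
      rw [sum_congr rfl (g := fun a => (ZMod.stdAddChar (x * a) : ℂ)), add_eq_left]
      · refine sum_eq_zero fun l hl => ?_
        simp [(mem_filter.1 hl).2]
      · intro l hl
        simp [hl]
    simp only [e] at this
    simpa using this
  have h4 : ∑ x : ZMod p, ‖∑ a ∈ A, (ZMod.stdAddChar (x * a) : ℂ)‖ ^ 4 = p * (κ * (#A : ℝ) ^ 2) := by
    rw [← hE, ← parseval]
    refine sum_congr rfl fun x _ => ?_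
    rw [← normsq_f, Complex.norm_real, Real.norm_of_nonneg (by positivity)]
    ring
  have h := holder3 univ (fun x : ZMod p => ‖∑ a ∈ A, (ZMod.stdAddChar (x * a) : ℂ)‖)
    (fun _ => norm_nonneg _)
  rw [h2, h4] at h
  set S := ∑ x : ZMod p, ‖∑ a ∈ A, (ZMod.stdAddChar (x * a) : ℂ)‖
  refine le_of_mul_le_mul_left (a := (p : ℝ) ^ 3 * (#A : ℝ) ^ 2) ?_ (by positivity)
  calc _ = (p * (#A : ℝ)) ^ 3 := by ring
    _ ≤ _ := h
    _ = _ := by field_simp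

end analytic

theorem main_bound (p : ℕ) (hp : p.Prime) (g : ℕ) (hg : IsPrimitiveRoot (g : ZMod p) (p - 1))
    (N : ℕ) (hN2 : 2 ≤ N) (hNp : (N : ℝ) < (p : ℝ) ^ ((1 : ℝ) / 2)) :
    (N : ℝ) ≤ (700 ^ 21 + 100 ^ 5 * 72 * 3 ^ 14 * (48 ^ 3 * 64 * 18432) ^ 2) *
      ((1 / (p : ℝ)) * ∑ x ∈ Finset.range p,
              ‖∑ n ∈ Finset.Icc 1 N,
                Complex.exp (2 * (Real.pi : ℂ) * Complex.I * (x : ℂ) *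
                  ((g ^ n : ℕ) : ℂ) / (p : ℂ))‖) ^ 42 := by
  have : Fact p.Prime := ⟨hp⟩
  have hp0 : 0 < p := hp.pos
  have hN0 : (0 : ℝ) < N := by positivity
  have hsq : N ^ 2 ≤ orderOf (g : ZMod p) := by
    rw [← hg.eq_orderOf]
    have h1 : (N : ℝ) ^ 2 < p := by
      calc (N : ℝ) ^ 2 < ((p : ℝ) ^ ((1 : ℝ) / 2)) ^ 2 := by gcongr
        _ = (p : ℝ) := by rw [← Real.sqrt_eq_rpow, Real.sq_sqrt (by positivity)]
    have h2 : N ^ 2 < p := by exact_mod_cast h1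
    omega
  set A := (Icc 1 N).image (fun n => (g : ZMod p) ^ n) with hA
  have hg0 : (g : ZMod p) ≠ 0 := by
    intro h0
    rw [h0] at hsq
    have : orderOf (0 : ZMod p) = 0 := by
      rw [orderOf_eq_zero_iff']
      intro n hn
      simp [hn.ne']
    rw [this] at hsq
    have : 0 < N ^ 2 := by positivity
    omega
  have hNo : N ≤ orderOf (g : ZMod p) := le_trans (by nlinarith) hsq
  have hinj : Set.InjOn (fun n => (g : ZMod p) ^ n) (Icc 1 N : Finset ℕ) := by
    intro i hi j hj hij
    simp only [coe_Icc, Set.mem_Icc] at hi hj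
    have hi' : i - 1 < orderOf (g : ZMod p) := by omega
    have hj' : j - 1 < orderOf (g : ZMod p) := by omega
    have : (g : ZMod p) ^ (i - 1) = (g : ZMod p) ^ (j - 1) := by
      refine mul_right_cancel₀ hg0 ?_
      rw [← pow_succ, ← pow_succ]
      rw [Nat.sub_add_cancel hi.1, Nat.sub_add_cancel hj.1]
      exact hij
    have := pow_injOn_Iio_orderOf hi' hj' this
    omega
  have hAc : #A = N := by rw [hA, card_image_of_injOn hinj]; simp
  have hAne : A.Nonempty := card_pos.1 (by omega)
  have hsum : ∑ x ∈ Finset.range p, ‖∑ n ∈ Finset.Icc 1 N,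
      Complex.exp (2 * (Real.pi : ℂ) * Complex.I * (x : ℂ) * ((g ^ n : ℕ) : ℂ) / (p : ℂ))‖ =
      ∑ x : ZMod p, ‖∑ a ∈ A, (ZMod.stdAddChar (x * a) : ℂ)‖ := by
    refine sum_bij (fun x _ => (x : ZMod p)) (fun _ _ => mem_univ _) ?_ ?_ ?_
    · intro a ha b hb hab
      rw [mem_range] at ha hb
      rw [ZMod.natCast_eq_natCast_iff'] at hab
      rwa [Nat.mod_eq_of_lt ha, Nat.mod_eq_of_lt hb] at hab
    · intro b _
      exact ⟨b.val, mem_range.2 (ZMod.val_lt b), ZMod.natCast_zmod_val b⟩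
    · intro x _
      rw [hA, sum_image hinj]
      congr 1
      refine sum_congr rfl fun n _ => ?_
      have : (x : ZMod p) * (g : ZMod p) ^ n = (((x * g ^ n : ℕ) : ℤ) : ZMod p) := by
        push_cast; rfl
      rw [this, ZMod.stdAddChar_coe]
      push_cast
      congr 1
      ring
  rw [hsum]
  set κ : ℝ := (∑ l, (rr A l : ℝ) ^ 2) / (N : ℝ) ^ 2 with hκ
  have hE : (∑ l, (rr A l : ℝ) ^ 2) = κ * (N : ℝ) ^ 2 := by
    rw [hκ]; field_simp
  have hL := L1_lower A κ hAne (by rw [hE, hAc])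
  rw [hAc] at hL
  set S := (1 / (p : ℝ)) * ∑ x : ZMod p, ‖∑ a ∈ A, (ZMod.stdAddChar (x * a) : ℂ)‖ with hS
  have hκ0 : 0 < κ := by
    by_contra h
    push Not at h
    nlinarith [sq_nonneg S]
  have hB := energy_bound (g : ZMod p) N (by omega) hsq κ hκ0 hE
  generalize (700 ^ 21 + 100 ^ 5 * 72 * 3 ^ 14 * (48 ^ 3 * 64 * 18432) ^ 2 : ℝ) = C at hB ⊢
  refine le_of_mul_le_mul_left (a := (N : ℝ) ^ 20) ?_ (by positivity)
  calc (N : ℝ) ^ 20 * N = (N : ℝ) ^ 21 := by ring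
    _ ≤ (κ * S ^ 2) ^ 21 := pow_le_pow_left₀ hN0.le hL 21
    _ = κ ^ 21 * S ^ 42 := by ring
    _ ≤ (C * (N : ℝ) ^ 20) * S ^ 42 :=
      mul_le_mul_of_nonneg_right hB ((by decide : Even 42).pow_nonneg S)
    _ = _ := by ring

theorem finish (C : ℝ) (hC : 1 ≤ C) (δ : ℝ) (hδ : 0 < δ) (N S : ℝ) (hN : 1 ≤ N) (hS : 0 ≤ S)
    (h : N ≤ C * S ^ 42) : C⁻¹ * N ^ ((1 : ℝ) / 48 - δ) ≤ S := by
  have hC0 : 0 < C := by linarith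
  have h1 : N ^ ((1 : ℝ) / 48 - δ) ≤ N ^ ((1 : ℝ) / 42) :=
    Real.rpow_le_rpow_of_exponent_le hN (by linarith)
  have h2 : N ≤ (C * S) ^ 42 := by
    refine h.trans ?_
    rw [mul_pow]
    refine mul_le_mul_of_nonneg_right ?_ (by positivity)
    exact le_self_pow₀ hC (by norm_num)
  have h3 : N ^ ((1 : ℝ) / 42) ≤ C * S := by
    calc N ^ ((1 : ℝ) / 42) ≤ ((C * S) ^ 42) ^ ((1 : ℝ) / 42) := by
          apply Real.rpow_le_rpow (by linarith) h2 (by norm_num)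
      _ = C * S := by
        rw [← Real.rpow_natCast, ← Real.rpow_mul (by positivity)]
        norm_num
  rw [inv_mul_le_iff₀ hC0]
  exact h1.trans h3

/-- **Theorem 5 (discrete Littlewood problem for powers of a primitive root).**
For every `δ > 0` there is `c = c(δ) > 0` such that for every prime `p`, every
primitive root `g` modulo `p` and every integer `N` with `2 ≤ N < p^{1/2}`, one has
`(1/p)·∑_{x=0}^{p−1} |∑_{n=1}^{N} e^{2πi x g^n / p}| ≥ c·N^{1/48 − δ}`. -/
theorem stmt_8 (δ : ℝ) (hδ : 0 < δ) :
    ∃ c : ℝ, 0 < c ∧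
      ∀ p : ℕ, p.Prime → ∀ g : ℕ, IsPrimitiveRoot (g : ZMod p) (p - 1) →
        ∀ N : ℕ, 2 ≤ N → (N : ℝ) < (p : ℝ) ^ ((1 : ℝ) / 2) →
          c * (N : ℝ) ^ ((1 : ℝ) / 48 - δ) ≤
            (1 / (p : ℝ)) * ∑ x ∈ Finset.range p,
              ‖∑ n ∈ Finset.Icc 1 N,
                Complex.exp (2 * (Real.pi : ℂ) * Complex.I * (x : ℂ) *
                  ((g ^ n : ℕ) : ℂ) / (p : ℂ))‖ := by

  refine ⟨(700 ^ 21 + 100 ^ 5 * 72 * 3 ^ 14 * (48 ^ 3 * 64 * 18432) ^ 2 : ℝ)⁻¹,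
    by positivity, ?_⟩
  intro p hp g hg N hN2 hNp
  have hN1 : (1 : ℝ) ≤ N := by exact_mod_cast (by omega : 1 ≤ N)
  refine finish _ (by norm_num) δ hδ N _ hN1 ?_ (main_bound p hp g hg N hN2 hNp)
  exact mul_nonneg (by positivity) (sum_nonneg fun _ _ => norm_nonneg _)
end

section
/- For every δ > 0 there exists a constant C = C(δ) > 0 such that for every prime p, every primitive root g modulo p, and every integer M with 1 < M < p^{1/2}, the number of quadruples (x, y, z, w) of integers with 1 ≤ x, y, z, w ≤ M and g^x + g^y ≡ g^z + g^w (mod p) is at most C·M^{3 − 1/24 + δ}. -/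
open Finset

/-- multiplicative progression -/
noncomputable def GP {F : Type*} [Field F] [DecidableEq F] (g : F) (N : ℕ) : Finset F :=
  (Finset.Icc (-(N:ℤ)) N).image (fun i => g ^ i)

section
variable {F : Type*} [Field F] [DecidableEq F]

lemma GP_card (g : F) (N : ℕ) : (GP g N).card ≤ 2 * N + 1 := by
  unfold GP
  refine card_image_le.trans ?_
  rw [Int.card_Icc]; omega

lemma mem_AP (g : F) (N : ℕ) (x : F) : x ∈ GP g N ↔ ∃ i : ℤ, (-(N:ℤ) ≤ i ∧ i ≤ N) ∧ g ^ i = x := by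
  simp [GP]

lemma GP_ne {g : F} (hg : g ≠ 0) {N : ℕ} {x : F} (h : x ∈ GP g N) : x ≠ 0 := by
  obtain ⟨i, -, rfl⟩ := (mem_AP _ _ _).1 h
  exact zpow_ne_zero _ hg

lemma GP_mul {g : F} (hg : g ≠ 0) {a b c : ℕ} {x y : F} (hx : x ∈ GP g a) (hy : y ∈ GP g b)
    (h : a + b ≤ c) : x * y ∈ GP g c := by
  obtain ⟨i, hi, rfl⟩ := (mem_AP _ _ _).1 hx
  obtain ⟨j, hj, rfl⟩ := (mem_AP _ _ _).1 hy
  exact (mem_AP _ _ _).2 ⟨i + j, by omega, zpow_add₀ hg _ _⟩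

lemma GP_div {g : F} (hg : g ≠ 0) {a b c : ℕ} {x y : F} (hx : x ∈ GP g a) (hy : y ∈ GP g b)
    (h : a + b ≤ c) : x / y ∈ GP g c := by
  obtain ⟨i, hi, rfl⟩ := (mem_AP _ _ _).1 hx
  obtain ⟨j, hj, rfl⟩ := (mem_AP _ _ _).1 hy
  exact (mem_AP _ _ _).2 ⟨i - j, by omega, zpow_sub₀ hg _ _⟩

lemma GP_pow (g : F) {i N : ℕ} (h : i ≤ N) : g ^ i ∈ GP g N :=
  (mem_AP _ _ _).2 ⟨i, by omega, by simp⟩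

/-- representations of `t` -/
noncomputable def RepSet (g d : F) (M : ℕ) (S : Finset F) (t : F) : Finset (F × F × F × F) :=
  (S ×ˢ GP g (3*M) ×ˢ GP g (3*M) ×ˢ GP g (3*M)).filter
    (fun q => t + d * q.1 = d * (q.2.1 - q.2.2.1 + q.2.2.2))

/-- pairs with given ratio -/
noncomputable def RatSet (d : F) (S : Finset F) (q : F) : Finset (F × F) :=
  (S ×ˢ S).filter (fun z => 1 + d * z.1 = q * (1 + d * z.2))

lemma bsg_count {g d : F} (hg : g ≠ 0) (hd : d ≠ 0) (M : ℕ) (S : Finset F)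
    (hS : ∀ k ∈ S, k ∈ GP g M ∧ 1 + d * k ∈ GP g M) (G : Finset F) (hG : G ⊆ S)
    {k1 k2 : F} (h1 : k1 ∈ S) (h2 : k2 ∈ S) :
    ∑ k ∈ G, (RatSet d S ((1 + d * k1) / (1 + d * k))).card * (RatSet d S ((1 + d * k2) / (1 + d * k))).card
      ≤ (RepSet g d M S (1 - (1 + d * k1) / (1 + d * k2))).card := by
  have hne : ∀ k ∈ S, 1 + d * k ≠ 0 := fun k hk => GP_ne hg (hS k hk).2
  simp_rw [← card_product]
  rw [← card_sigma]
  have ha1 := hne _ h1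
  have ha2 := hne _ h2
  refine card_le_card_of_injOn (fun z : (Σ _ : F, (F × F) × (F × F)) =>
    (z.2.1.1, (1 + d * k1) / (1 + d * z.1) * z.2.1.2, (1 + d * k1) / (1 + d * z.1) * z.2.2.2,
      (1 + d * k1) / (1 + d * k2) * z.2.2.1)) ?_ ?_
  · rintro ⟨k, ⟨e, e'⟩, ⟨f, f'⟩⟩ hz
    simp only [coe_sigma, Set.mem_sigma_iff, mem_coe, mem_product, RatSet, mem_filter] at hz
    obtain ⟨hk, ⟨⟨he, he'⟩, hE⟩, ⟨hf, hf'⟩, hF⟩ := hz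
    have hk0 := hne _ (hG hk)
    simp only [RepSet, mem_coe, mem_filter, mem_product]
    refine ⟨⟨he, ?_, ?_, ?_⟩, ?_⟩
    · exact GP_mul hg (GP_div hg (hS _ h1).2 (hS _ (hG hk)).2 le_rfl) (hS _ he').1 (by omega)
    · exact GP_mul hg (GP_div hg (hS _ h1).2 (hS _ (hG hk)).2 le_rfl) (hS _ hf').1 (by omega)
    · exact GP_mul hg (GP_div hg (hS _ h1).2 (hS _ h2).2 le_rfl) (hS _ hf).1 (by omega)
    · have hE' : d * e = (1 + d * k1) / (1 + d * k) * (1 + d * e') - 1 := by rw [← hE]; ring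
      have hF' : (1 + d * k1) / (1 + d * k2) * (1 + d * f) = (1 + d * k1) / (1 + d * k) * (1 + d * f') := by
        rw [hF]; field_simp
      rw [hE']
      linear_combination -hF'
  · rintro ⟨k, ⟨e, e'⟩, ⟨f, f'⟩⟩ hz ⟨l, ⟨u, u'⟩, ⟨v, v'⟩⟩ hw heq
    simp only [coe_sigma, Set.mem_sigma_iff, mem_coe, mem_product, RatSet, mem_filter] at hz hw
    obtain ⟨hk, ⟨⟨he, he'⟩, hE⟩, ⟨hf, hf'⟩, hF⟩ := hz
    obtain ⟨hl, ⟨⟨hu, hu'⟩, hU⟩, ⟨hv, hv'⟩, hV⟩ := hw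
    have hk0 := hne _ (hG hk)
    have hl0 := hne _ (hG hl)
    simp only [Prod.mk.injEq] at heq
    obtain ⟨e1, e2, e3, e4⟩ := heq
    subst e1
    have hq : (1 + d * k1) / (1 + d * k) = (1 + d * k1) / (1 + d * l) := by
      linear_combination -hE + hU - d * e2
    have hkl : k = l := by
      rw [div_eq_div_iff hk0 hl0] at hq
      have := mul_left_cancel₀ ha1 hq
      exact mul_left_cancel₀ hd (by linear_combination -this)
    subst hkl
    have q0 : (1 + d * k1) / (1 + d * k) ≠ 0 := div_ne_zero ha1 hk0
    have q1 : (1 + d * k1) / (1 + d * k2) ≠ 0 := div_ne_zero ha1 ha2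
    have := mul_left_cancel₀ q0 e2
    have := mul_left_cancel₀ q0 e3
    have := mul_left_cancel₀ q1 e4
    subst_vars
    rfl

lemma bsg {g d : F} (hg : g ≠ 0) (hd : d ≠ 0) (M n : ℕ) (S : Finset F) (hn : S.card = n)
    (hS : ∀ k ∈ S, k ∈ GP g M ∧ 1 + d * k ∈ GP g M) :
    ∃ T ⊆ S, n ≤ 2 * T.card ∧ ∀ k1 ∈ T, ∀ k2 ∈ T,
      n ^ 5 ≤ 128 * (4 * M + 1) ^ 2 * (RepSet g d M S (1 - (1 + d * k1) / (1 + d * k2))).card := by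
  have hne : ∀ k ∈ S, 1 + d * k ≠ 0 := fun k hk => GP_ne hg (hS k hk).2
  rcases Nat.eq_zero_or_pos n with h0 | hpos
  · exact ⟨∅, by simp, by simp [h0], by simp⟩
  set L := 4 * M + 1 with hL
  let a : F → F := fun k => 1 + d * k
  let bad : F → F → Prop := fun k1 k => 8 * L * (RatSet d S (a k1 / a k)).card < n ^ 2
  classical
  let B : F → Finset F := fun k1 => S.filter (bad k1)
  have hB : 8 * ∑ k ∈ S, (B k).card ≤ n ^ 2 := by
    have h1 : ∑ k ∈ S, (B k).card ≤
        ∑ q ∈ (GP g (2*M)).filter (fun q => 8 * L * (RatSet d S q).card < n ^ 2), (RatSet d S q).card := by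
      rw [← card_sigma, ← card_sigma]
      refine card_le_card_of_injOn (fun z : (Σ _ : F, F) => (⟨a z.1 / a z.2, (z.1, z.2)⟩ : Σ _ : F, F × F)) ?_ ?_
      · rintro ⟨k, l⟩ hz
        simp only [coe_sigma, Set.mem_sigma_iff, mem_coe, B, mem_filter] at hz
        obtain ⟨hk, hl, hb⟩ := hz
        refine mem_coe.2 (mem_sigma.2 ⟨mem_filter.2 ⟨GP_div hg (hS _ hk).2 (hS _ hl).2 (by omega), hb⟩,
          mem_filter.2 ⟨mem_product.2 ⟨hk, hl⟩, ?_⟩⟩)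
        have := hne _ hl
        simp only [a]; field_simp
      · rintro ⟨k, l⟩ hz ⟨k', l'⟩ hz' h
        simp at h
        simp [h.2.1, h.2.2]
    have h2 : 8 * L * ∑ q ∈ (GP g (2*M)).filter (fun q => 8 * L * (RatSet d S q).card < n ^ 2), (RatSet d S q).card
        ≤ L * n ^ 2 := by
      rw [mul_sum]
      refine (sum_le_card_nsmul _ _ (n^2) ?_).trans ?_
      · intro q hq; exact (mem_filter.1 hq).2.le
      · rw [smul_eq_mul]
        exact Nat.mul_le_mul_right _ ((card_filter_le _ _).trans ((GP_card _ _).trans (by omega)))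
    have h3 : L * (8 * ∑ k ∈ S, (B k).card) ≤ L * n ^ 2 := by
      refine le_trans ?_ h2
      calc L * (8 * ∑ k ∈ S, (B k).card) = 8 * L * ∑ k ∈ S, (B k).card := by ring
        _ ≤ _ := Nat.mul_le_mul_left _ h1
    exact Nat.le_of_mul_le_mul_left h3 (by omega)
  refine ⟨S.filter (fun k => 4 * (B k).card ≤ n), filter_subset _ _, ?_, ?_⟩
  · have h1 : (S.filter (fun k => ¬ 4 * (B k).card ≤ n)).card * n ≤ 4 * ∑ k ∈ S, (B k).card := by
      rw [mul_sum, ← smul_eq_mul]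
      refine (card_nsmul_le_sum _ (fun k => 4 * (B k).card) n ?_).trans
        (sum_le_sum_of_subset (filter_subset _ _))
      intro k hk
      have := (mem_filter.1 hk).2
      omega
    have h2 := card_filter_add_card_filter_not (s := S) (fun k => 4 * (B k).card ≤ n)
    rw [hn] at h2
    have h3 : n * (2 * (S.filter (fun k => ¬ 4 * (B k).card ≤ n)).card) ≤ n * n := by nlinarith
    have := Nat.le_of_mul_le_mul_left h3 hpos
    omega
  · intro k1 hk1 k2 hk2
    obtain ⟨hk1, hb1⟩ := mem_filter.1 hk1
    obtain ⟨hk2, hb2⟩ := mem_filter.1 hk2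
    let G := S \ (B k1 ∪ B k2)
    have hGc : n ≤ 2 * G.card := by
      have h1 := card_union_le (B k1) (B k2)
      have h2 := le_card_sdiff (B k1 ∪ B k2) S
      change _ ≤ G.card at h2
      omega
    refine le_trans ?_ (Nat.mul_le_mul_left _ (bsg_count hg hd M S hS G sdiff_subset hk1 hk2))
    have h3 : G.card * n ^ 4 ≤ 64 * L ^ 2 * ∑ k ∈ G, (RatSet d S ((1 + d * k1) / (1 + d * k))).card *
        (RatSet d S ((1 + d * k2) / (1 + d * k))).card := by
      rw [mul_sum, ← smul_eq_mul]
      refine card_nsmul_le_sum _ _ _ ?_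
      intro k hk
      simp only [G, B, mem_sdiff, mem_union, mem_filter, not_or, not_and, bad, not_lt] at hk
      obtain ⟨hk, i1, i2⟩ := hk
      have := Nat.mul_le_mul (i1 hk) (i2 hk)
      calc n ^ 4 = n ^ 2 * n ^ 2 := by ring
        _ ≤ _ := this
        _ = _ := by simp only [a]; ring
    calc n ^ 5 = n * n ^ 4 := by ring
      _ ≤ 2 * G.card * n ^ 4 := Nat.mul_le_mul_right _ hGc
      _ = 2 * (G.card * n ^ 4) := by ring
      _ ≤ 2 * _ := Nat.mul_le_mul_left _ h3
      _ = _ := by ring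
end

section
variable {F : Type*} [Field F] [DecidableEq F]

/-- representations with four terms -/
noncomputable def Rep4 (g d : F) (M : ℕ) (w : F) : Finset (F × F × F × F) :=
  (GP g (5*M) ×ˢ GP g (5*M) ×ˢ GP g (5*M) ×ˢ GP g (5*M)).filter
    (fun q => w + d * q.1 = d * (q.2.1 - q.2.2.1 + q.2.2.2))

lemma rep_le_rep4 {g d : F} (hg : g ≠ 0) (M : ℕ) (S : Finset F)
    (hS : ∀ k ∈ S, k ∈ GP g M) (t : F) (j : ℕ) (hj : j ≤ 2 * M) :
    (RepSet g d M S t).card ≤ (Rep4 g d M (g ^ j * t)).card := by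
  have hj0 : g ^ j ≠ 0 := pow_ne_zero _ hg
  refine card_le_card_of_injOn (fun q => (g ^ j * q.1, g ^ j * q.2.1, g ^ j * q.2.2.1, g ^ j * q.2.2.2)) ?_ ?_
  · rintro ⟨k, a, b, c⟩ hz
    simp only [RepSet, mem_coe, mem_filter, mem_product] at hz
    obtain ⟨⟨hk, ha, hb, hc⟩, h⟩ := hz
    simp only [Rep4, mem_coe, mem_filter, mem_product]
    have hp := GP_pow g hj
    refine ⟨⟨GP_mul hg hp (hS _ hk) (by omega), GP_mul hg hp ha (by omega), GP_mul hg hp hb (by omega),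
      GP_mul hg hp hc (by omega)⟩, ?_⟩
    linear_combination g ^ j * h
  · rintro ⟨k, a, b, c⟩ - ⟨k', a', b', c'⟩ - h
    simpa [hg] using h

lemma W_bound [Fintype F] {g d : F} (hg : g ≠ 0) (hd : d ≠ 0) (M n : ℕ) (hM : 1 ≤ M) (hnM : n ≤ M)
    (hcard : M ^ 2 + 1 ≤ Fintype.card F)
    (hinj : ∀ i j : ℕ, i ≤ M → j ≤ M → g ^ i = g ^ j → i = j)
    (S1 S2 : Finset F) (hS1 : ∀ k ∈ S1, k ∈ GP g M) (hS2 : ∀ k ∈ S2, k ∈ GP g M)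
    (N1 N2 : F → Prop) (hN1 : ∀ t, N1 t → t ≠ 0)
    (h1 : ∀ t, N1 t → n ^ 5 ≤ 128 * (4 * M + 1) ^ 2 * (RepSet g d M S1 t).card)
    (h2 : ∀ t, N2 t → n ^ 5 ≤ 128 * (4 * M + 1) ^ 2 * (RepSet g d M S2 t).card)
    (hcov : ∀ z : F, z ≠ 0 → ∃ i < M, ∃ s t, N2 s ∧ N1 t ∧ z = g ^ i * (s / t)) :
    n ^ 12 ≤ 10 ^ 16 * M ^ 11 := by
  classical
  set K := 128 * (4 * M + 1) ^ 2 with hK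
  let Y : Finset F := univ.filter (fun w => n ^ 5 ≤ K * (Rep4 g d M w).card)
  have hY : Y.card * n ^ 5 ≤ K * (10 * M + 1) ^ 4 := by
    have e1 : Y.card * n ^ 5 ≤ K * ∑ w ∈ Y, (Rep4 g d M w).card := by
      rw [mul_sum, ← smul_eq_mul]
      exact card_nsmul_le_sum _ _ _ (fun w hw => (mem_filter.1 hw).2)
    refine e1.trans (Nat.mul_le_mul_left _ ?_)
    rw [← card_sigma]
    have e2 : (GP g (5*M) ×ˢ GP g (5*M) ×ˢ GP g (5*M) ×ˢ GP g (5*M)).card ≤ (10 * M + 1) ^ 4 := by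
      simp only [card_product]
      have := GP_card g (5*M)
      have h' : (GP g (5*M)).card ≤ 10 * M + 1 := by omega
      calc _ = (GP g (5*M)).card ^ 4 := by ring
        _ ≤ _ := Nat.pow_le_pow_left h' 4
    refine le_trans ?_ e2
    refine card_le_card_of_injOn (fun z : (Σ _ : F, F × F × F × F) => z.2) ?_ ?_
    · rintro ⟨w, q⟩ hz
      simp only [coe_sigma, Set.mem_sigma_iff, mem_coe, Rep4, mem_filter] at hz
      exact hz.2.1
    · rintro ⟨w, q⟩ hz ⟨w', q'⟩ hz' h
      simp only [coe_sigma, Set.mem_sigma_iff, mem_coe, Rep4, mem_filter] at hz hz' h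
      subst h
      have : w = w' := by linear_combination hz.2.2 - hz'.2.2
      subst this; rfl
  choose! I hI s t hs ht hz using hcov
  have hW : (univ.erase (0:F) ×ˢ range M).card ≤ (Y ×ˢ Y).card := by
    refine card_le_card_of_injOn (fun z => (g ^ (I z.1 + z.2) * s z.1, g ^ z.2 * t z.1)) ?_ ?_
    · rintro ⟨z, j⟩ h
      simp only [coe_product, Set.mem_prod, mem_coe, mem_erase, mem_range] at h
      obtain ⟨⟨h0, -⟩, hj⟩ := h
      simp only [coe_product, Set.mem_prod, mem_coe, Y, mem_filter, mem_univ, true_and]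
      have := hI z h0
      exact ⟨(h2 _ (hs z h0)).trans (Nat.mul_le_mul_left _ (rep_le_rep4 hg M S2 hS2 _ _ (by omega))),
        (h1 _ (ht z h0)).trans (Nat.mul_le_mul_left _ (rep_le_rep4 hg M S1 hS1 _ _ (by omega)))⟩
    · rintro ⟨z, j⟩ h ⟨z', j'⟩ h' heq
      simp only [coe_product, Set.mem_prod, mem_coe, mem_erase, mem_range] at h h'
      obtain ⟨⟨h0, -⟩, hj⟩ := h
      obtain ⟨⟨h0', -⟩, hj'⟩ := h'
      simp only [Prod.mk.injEq] at heq
      obtain ⟨e1, e2⟩ := heq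
      have r : ∀ z j, z ≠ 0 → z = (g ^ (I z + j) * s z) / (g ^ j * t z) := by
        intro z j h0
        conv_lhs => rw [hz z h0]
        have := hN1 _ (ht z h0)
        have : g ^ j ≠ 0 := pow_ne_zero _ hg
        rw [pow_add]
        field_simp
      have : z = z' := by rw [r z j h0, r z' j' h0', e1, e2]
      subst this
      have := mul_right_cancel₀ (hN1 _ (ht z h0)) e2
      have := hinj _ _ hj.le hj'.le this
      rw [this]
  rw [card_product, card_product, card_range, card_erase_of_mem (mem_univ _), card_univ] at hW
  have hW' : M ^ 2 * M ≤ Y.card * Y.card := le_trans (Nat.mul_le_mul_right _ (by omega)) hW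
  have hK' : K ≤ 3200 * M ^ 2 := by
    have : 4 * M + 1 ≤ 5 * M := by omega
    calc K ≤ 128 * (5 * M) ^ 2 := Nat.mul_le_mul_left _ (Nat.pow_le_pow_left this 2)
      _ = _ := by ring
  have h10 : (10 * M + 1) ^ 4 ≤ (11 * M) ^ 4 := Nat.pow_le_pow_left (by omega) 4
  have hY' : Y.card * n ^ 5 ≤ 3200 * M ^ 2 * (11 * M) ^ 4 := hY.trans (Nat.mul_le_mul hK' h10)
  have f1 : M ^ 3 * n ^ 10 ≤ M ^ 3 * (10 ^ 16 * M ^ 9) := by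
    calc M ^ 3 * n ^ 10 = M ^ 2 * M * n ^ 10 := by ring
      _ ≤ Y.card * Y.card * n ^ 10 := Nat.mul_le_mul_right _ hW'
      _ = (Y.card * n ^ 5) ^ 2 := by ring
      _ ≤ (3200 * M ^ 2 * (11 * M) ^ 4) ^ 2 := Nat.pow_le_pow_left hY' 2
      _ = (3200 * 11 ^ 4) ^ 2 * M ^ 12 := by ring
      _ ≤ 10 ^ 16 * M ^ 12 := Nat.mul_le_mul_right _ (by norm_num)
      _ = _ := by ring
  have f2 := Nat.le_of_mul_le_mul_left f1 (by positivity)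
  calc n ^ 12 = n ^ 10 * n ^ 2 := by ring
    _ ≤ (10 ^ 16 * M ^ 9) * M ^ 2 := Nat.mul_le_mul f2 (Nat.pow_le_pow_left hnM 2)
    _ = _ := by ring

lemma gap {g : F} (M : ℕ) (hgen : ∀ z : F, z ≠ 0 → ∃ m : ℕ, g ^ m = z)
    (Q : F → Prop) (q0 : F) (hq0 : Q q0) (hne : q0 ≠ 0)
    (h : ∀ r, Q r → ∃ f : ℕ, 1 ≤ f ∧ f ≤ M ∧ Q (g ^ f * r)) (z : F) (hz : z ≠ 0) :
    ∃ i < M, ∃ q, Q q ∧ z = g ^ i * q := by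
  choose! f hf1 hf2 hf3 using h
  have key : ∀ m : ℕ, ∃ i, ∃ q, Q q ∧ i < f q ∧ g ^ m * q0 = g ^ i * q := by
    intro m
    induction m with
    | zero => exact ⟨0, q0, hq0, hf1 _ hq0, rfl⟩
    | succ m ih =>
      obtain ⟨i, q, hq, hi, e⟩ := ih
      rcases Nat.lt_or_ge (i + 1) (f q) with h | h
      · exact ⟨i + 1, q, hq, h, by rw [pow_succ', pow_succ', mul_assoc, e, mul_assoc]⟩
      · have : f q = i + 1 := by omega
        refine ⟨0, g ^ f q * q, hf3 _ hq, hf1 _ (hf3 _ hq), ?_⟩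
        rw [this, pow_succ', pow_succ', mul_assoc, e]; ring
  obtain ⟨m, hm⟩ := hgen (z / q0) (div_ne_zero hz hne)
  obtain ⟨i, q, hq, hi, e⟩ := key m
  refine ⟨i, hi.trans_le (hf2 _ hq), q, hq, ?_⟩
  rw [← e, hm]; field_simp

/-- differences -/
def NN (d : F) (T : Finset F) (t : F) : Prop :=
  ∃ k1 ∈ T, ∃ k2 ∈ T, k1 ≠ k2 ∧ t = 1 - (1 + d * k1) / (1 + d * k2)

lemma NN_ne {d : F} (hd : d ≠ 0) {T : Finset F} (hT : ∀ k ∈ T, 1 + d * k ≠ 0) {t : F} (h : NN d T t) :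
    t ≠ 0 := by
  obtain ⟨k1, h1, k2, h2, hne, rfl⟩ := h
  intro h0
  have := hT _ h2
  field_simp at h0
  apply hne
  exact mul_left_cancel₀ hd (by linear_combination -h0)

lemma final {g d : F} (hg : g ≠ 0) (hd : d ≠ 0) (M n : ℕ) (hM : 1 ≤ M)
    (S1 S2 T1 T2 : Finset F) (hS1 : ∀ k ∈ S1, k ∈ GP g M ∧ 1 + d * k ∈ GP g M)
    (hS2 : ∀ k ∈ S2, k ∈ GP g M ∧ 1 + d * k ∈ GP g M)
    (hsep : ∀ k ∈ S1, ∀ k' ∈ S2, ∃ f : ℕ, 1 ≤ f ∧ f ≤ M ∧ k = g ^ f * k')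
    (hT1 : T1 ⊆ S1) (hT2 : T2 ⊆ S2) (hc1 : n ≤ 2 * T1.card) (hc2 : n ≤ 2 * T2.card) (s t : F)
    (hs : s ≠ 0) (ht : t ≠ 0)
    (h1 : n ^ 5 ≤ 128 * (4 * M + 1) ^ 2 * (RepSet g d M S1 t).card)
    (h2 : n ^ 5 ≤ 128 * (4 * M + 1) ^ 2 * (RepSet g d M S2 s).card)
    (hno : ∀ f : ℕ, 1 ≤ f → f ≤ M → ∀ s' t', NN d T2 s' → NN d T1 t' → g ^ f * (s / t) ≠ s' / t') :
    n ^ 12 ≤ 10 ^ 16 * M ^ 11 := by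
  have hn1 : ∀ k ∈ S1, 1 + d * k ≠ 0 := fun k hk => GP_ne hg (hS1 k hk).2
  have hn2 : ∀ k ∈ S2, 1 + d * k ≠ 0 := fun k hk => GP_ne hg (hS2 k hk).2
  have hk1 : ∀ k ∈ S1, k ≠ 0 := fun k hk => GP_ne hg (hS1 k hk).1
  have hk2 : ∀ k ∈ S2, k ≠ 0 := fun k hk => GP_ne hg (hS2 k hk).1
  have hle : ((T2 ×ˢ T1) ×ˢ (RepSet g d M S1 t ×ˢ RepSet g d M S2 s)).card ≤
      (GP g (4*M) ×ˢ (GP g (4*M) ×ˢ GP g (4*M) ×ˢ GP g (4*M)) ×ˢ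
        (GP g (6*M) ×ˢ GP g (6*M) ×ˢ GP g (6*M))).card := by
    refine card_le_card_of_injOn (fun z =>
      (z.2.1.1 / (1 + d * z.1.1) / (z.2.2.1 / (1 + d * z.1.2)),
       (z.2.1.2.1 / (1 + d * z.1.1), z.2.1.2.2.1 / (1 + d * z.1.1), z.2.1.2.2.2 / (1 + d * z.1.1)),
       (z.2.1.1 / (1 + d * z.1.1) / z.2.2.1 * z.2.2.2.1,
        z.2.1.1 / (1 + d * z.1.1) / z.2.2.1 * z.2.2.2.2.1,
        z.2.1.1 / (1 + d * z.1.1) / z.2.2.1 * z.2.2.2.2.2))) ?_ ?_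
    · rintro ⟨⟨u, v⟩, ⟨k, a, b, c⟩, ⟨k', a', b', c'⟩⟩ hz
      simp only [RepSet, mem_coe, mem_filter, mem_product] at hz
      obtain ⟨⟨hu, hv⟩, ⟨⟨hk, ha, hb, hc⟩, -⟩, ⟨hk', ha', hb', hc'⟩, -⟩ := hz
      simp only [mem_coe, mem_product]
      have iu := (hS2 _ (hT2 hu)).2
      have iv := (hS1 _ (hT1 hv)).2
      have ik := (hS1 _ hk).1
      have ik' := (hS2 _ hk').1
      have x1 := GP_div hg ik iu (c := 2 * M) (by omega)
      have x2 := GP_div hg ik' iv (c := 2 * M) (by omega)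
      have x3 := GP_div hg x1 ik' (c := 3 * M) (by omega)
      exact ⟨GP_div hg x1 x2 (by omega),
        ⟨GP_div hg ha iu (by omega), GP_div hg hb iu (by omega), GP_div hg hc iu (by omega)⟩,
        GP_mul hg x3 ha' (by omega), GP_mul hg x3 hb' (by omega), GP_mul hg x3 hc' (by omega)⟩
    · rintro ⟨⟨u, v⟩, ⟨k, a, b, c⟩, ⟨k', a', b', c'⟩⟩ hz
        ⟨⟨u2, v2⟩, ⟨l, a2, b2, c2⟩, ⟨l', a2', b2', c2'⟩⟩ hw heq
      simp only [RepSet, mem_coe, mem_filter, mem_product] at hz hw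
      obtain ⟨⟨hu, hv⟩, ⟨⟨hk, -, -, -⟩, E⟩, ⟨hk', -, -, -⟩, E'⟩ := hz
      obtain ⟨⟨hu2, hv2⟩, ⟨⟨hl, -, -, -⟩, D⟩, ⟨hl', -, -, -⟩, D'⟩ := hw
      simp only [Prod.mk.injEq] at heq
      obtain ⟨e, ⟨ea, eb, ec⟩, fa, fb, fc⟩ := heq
      have nu := hn2 _ (hT2 hu)
      have nv := hn1 _ (hT1 hv)
      have nu2 := hn2 _ (hT2 hu2)
      have nv2 := hn1 _ (hT1 hv2)
      have nk := hk1 _ hk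
      have nk' := hk2 _ hk'
      have nl := hk1 _ hl
      have nl' := hk2 _ hl'
      set η := k / (1 + d * u) / (k' / (1 + d * v)) with hη
      have η0 : η ≠ 0 := div_ne_zero (div_ne_zero nk nu) (div_ne_zero nk' nv)
      have w1 : k / (1 + d * u) / k' = η / (1 + d * v) := by rw [hη]; field_simp
      have w2 : l / (1 + d * u2) / l' = η / (1 + d * v2) := by rw [e]; field_simp
      have m1 : t / (1 + d * u) - s * η / (1 + d * v) =
          t / (1 + d * u2) - s * η / (1 + d * v2) := by
        have p1 : t / (1 + d * u) - s * η / (1 + d * v) =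
          d * (a / (1 + d * u) - b / (1 + d * u) + c / (1 + d * u)) -
          d * (k / (1 + d * u) / k' * a' - k / (1 + d * u) / k' * b' + k / (1 + d * u) / k' * c') := by
          have q1 : t = d * (a - b + c) - d * k := by linear_combination E
          have q2 : s = d * (a' - b' + c') - d * k' := by linear_combination E'
          rw [q1, q2, hη]; field_simp; ring
        have p2 : t / (1 + d * u2) - s * η / (1 + d * v2) =
          d * (a2 / (1 + d * u2) - b2 / (1 + d * u2) + c2 / (1 + d * u2)) -
          d * (l / (1 + d * u2) / l' * a2' - l / (1 + d * u2) / l' * b2' + l / (1 + d * u2) / l' * c2') := by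
          have q1 : t = d * (a2 - b2 + c2) - d * l := by linear_combination D
          have q2 : s = d * (a2' - b2' + c2') - d * l' := by linear_combination D'
          rw [q1, q2, e]; field_simp; ring
        rw [p1, p2, ea, eb, ec, fa, fb, fc]
      have hvv : v = v2 := by
        by_contra hvv
        have N1 : NN d T1 (1 - (1 + d * v) / (1 + d * v2)) := ⟨v, hv, v2, hv2, hvv, rfl⟩
        have N1' := NN_ne hd (fun k hk => hn1 k (hT1 hk)) N1
        have m2 : t * (1 - (1 + d * u) / (1 + d * u2)) = s * (k / k') * (1 - (1 + d * v) / (1 + d * v2)) := by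
          have hηk : η * (1 + d * u) / (1 + d * v) = k / k' := by rw [hη]; field_simp
          have : t * (1 - (1 + d * u) / (1 + d * u2)) =
            s * (η * (1 + d * u) / (1 + d * v)) * (1 - (1 + d * v) / (1 + d * v2)) := by
            have : t * (1 - (1 + d * u) / (1 + d * u2)) = (1 + d * u) * (t / (1 + d * u) - t / (1 + d * u2)) := by
              field_simp
            rw [this]
            have : t / (1 + d * u) - t / (1 + d * u2) = s * η / (1 + d * v) - s * η / (1 + d * v2) := by
              linear_combination m1
            rw [this]; field_simp
          rw [this, hηk]
        have huu : u ≠ u2 := by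
          rintro rfl
          rw [div_self nu, sub_self, mul_zero] at m2
          exact mul_ne_zero (mul_ne_zero hs (div_ne_zero nk nk')) N1' m2.symm
        have N2 : NN d T2 (1 - (1 + d * u) / (1 + d * u2)) := ⟨u, hu, u2, hu2, huu, rfl⟩
        obtain ⟨f, hf1, hf2, hf⟩ := hsep k hk k' hk'
        refine hno f hf1 hf2 _ _ N2 N1 ?_
        rw [← mul_div_assoc, div_eq_div_iff ht N1']
        have : k / k' = g ^ f := by rw [hf]; field_simp
        rw [this] at m2
        linear_combination -m2
      subst hvv
      have huu : u = u2 := by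
        have m3 : t / (1 + d * u) = t / (1 + d * u2) := by linear_combination m1
        rw [div_eq_div_iff nu nu2] at m3
        have := mul_left_cancel₀ ht m3
        exact mul_left_cancel₀ hd (by linear_combination -this)
      subst huu
      have ea' := (div_left_inj' nu).1 ea
      have eb' := (div_left_inj' nu).1 eb
      have ec' := (div_left_inj' nu).1 ec
      have hx : η / (1 + d * v) ≠ 0 := div_ne_zero η0 nv
      rw [w1, w2] at fa fb fc
      have fa' := mul_left_cancel₀ hx fa
      have fb' := mul_left_cancel₀ hx fb
      have fc' := mul_left_cancel₀ hx fc
      subst ea' eb' ec' fa' fb' fc'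
      have : k = l := mul_left_cancel₀ hd (by linear_combination E - D)
      have : k' = l' := mul_left_cancel₀ hd (by linear_combination E' - D')
      subst_vars
      rfl
  simp only [card_product] at hle
  have c4 : (GP g (4*M)).card ≤ 9 * M := (GP_card g _).trans (by omega)
  have c6 : (GP g (6*M)).card ≤ 13 * M := (GP_card g _).trans (by omega)
  have c : T2.card * T1.card * ((RepSet g d M S1 t).card * (RepSet g d M S2 s).card) ≤ (9 * M) ^ 4 * (13 * M) ^ 3 := by
    refine hle.trans ?_
    calc _ = (GP g (4*M)).card ^ 4 * (GP g (6*M)).card ^ 3 := by ring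
      _ ≤ _ := Nat.mul_le_mul (Nat.pow_le_pow_left c4 4) (Nat.pow_le_pow_left c6 3)
  have hK' : 128 * (4 * M + 1) ^ 2 ≤ 3200 * M ^ 2 := by
    have : 4 * M + 1 ≤ 5 * M := by omega
    calc _ ≤ 128 * (5 * M) ^ 2 := Nat.mul_le_mul_left _ (Nat.pow_le_pow_left this 2)
      _ = _ := by ring
  have h1' := h1.trans (Nat.mul_le_mul_right _ hK')
  have h2' := h2.trans (Nat.mul_le_mul_right _ hK')
  calc n ^ 12 = (n * n) * (n ^ 5 * n ^ 5) := by ring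
    _ ≤ (2 * T2.card * (2 * T1.card)) * ((3200 * M ^ 2 * (RepSet g d M S1 t).card) * (3200 * M ^ 2 * (RepSet g d M S2 s).card)) :=
      Nat.mul_le_mul (Nat.mul_le_mul hc2 hc1) (Nat.mul_le_mul h1' h2')
    _ = 4 * 3200 ^ 2 * M ^ 4 * (T2.card * T1.card * ((RepSet g d M S1 t).card * (RepSet g d M S2 s).card)) := by ring
    _ ≤ 4 * 3200 ^ 2 * M ^ 4 * ((9 * M) ^ 4 * (13 * M) ^ 3) := Nat.mul_le_mul_left _ c
    _ = (4 * 3200 ^ 2 * 9 ^ 4 * 13 ^ 3) * M ^ 11 := by ring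
    _ ≤ _ := Nat.mul_le_mul_right _ (by norm_num)

lemma two_sets [Fintype F] {g d : F} (hg : g ≠ 0) (hd : d ≠ 0) (M n : ℕ) (hM : 1 ≤ M) (hnM : n ≤ M)
    (hcard : M ^ 2 + 1 ≤ Fintype.card F)
    (hinj : ∀ i j : ℕ, i ≤ M → j ≤ M → g ^ i = g ^ j → i = j)
    (hgen : ∀ z : F, z ≠ 0 → ∃ m : ℕ, g ^ m = z)
    (S1 S2 : Finset F) (hS1 : ∀ k ∈ S1, k ∈ GP g M ∧ 1 + d * k ∈ GP g M)
    (hS2 : ∀ k ∈ S2, k ∈ GP g M ∧ 1 + d * k ∈ GP g M)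
    (hsep : ∀ k ∈ S1, ∀ k' ∈ S2, ∃ f : ℕ, 1 ≤ f ∧ f ≤ M ∧ k = g ^ f * k')
    (hn1 : S1.card = n) (hn2 : S2.card = n) : n ^ 12 ≤ 10 ^ 16 * M ^ 11 := by
  rcases Nat.lt_or_ge n 3 with h3 | h3
  · calc n ^ 12 ≤ 3 ^ 12 := Nat.pow_le_pow_left h3.le _
      _ ≤ 10 ^ 16 * 1 := by norm_num
      _ ≤ _ := Nat.mul_le_mul_left _ (Nat.one_le_pow _ _ hM)
  obtain ⟨T1, hT1, hc1, hr1⟩ := bsg hg hd M n S1 hn1 hS1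
  obtain ⟨T2, hT2, hc2, hr2⟩ := bsg hg hd M n S2 hn2 hS2
  have ne1 : ∀ k ∈ T1, 1 + d * k ≠ 0 := fun k hk => GP_ne hg (hS1 k (hT1 hk)).2
  have ne2 : ∀ k ∈ T2, 1 + d * k ≠ 0 := fun k hk => GP_ne hg (hS2 k (hT2 hk)).2
  have R1 : ∀ t, NN d T1 t → n ^ 5 ≤ 128 * (4 * M + 1) ^ 2 * (RepSet g d M S1 t).card := by
    rintro t ⟨k1, h1, k2, h2, -, rfl⟩; exact hr1 _ h1 _ h2
  have R2 : ∀ t, NN d T2 t → n ^ 5 ≤ 128 * (4 * M + 1) ^ 2 * (RepSet g d M S2 t).card := by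
    rintro t ⟨k1, h1, k2, h2, -, rfl⟩; exact hr2 _ h1 _ h2
  have ex : ∀ T : Finset F, n ≤ 2 * T.card → ∃ t, NN d T t := by
    intro T hT
    obtain ⟨a, ha, b, hb, hab⟩ := Finset.one_lt_card.1 (show 1 < T.card by omega)
    exact ⟨_, a, ha, b, hb, hab, rfl⟩
  obtain ⟨t0, ht0⟩ := ex T1 hc1
  obtain ⟨s0, hs0⟩ := ex T2 hc2
  by_cases hq : ∀ r, (∃ s t, NN d T2 s ∧ NN d T1 t ∧ r = s / t) → ∃ f : ℕ, 1 ≤ f ∧ f ≤ M ∧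
      (∃ s t, NN d T2 s ∧ NN d T1 t ∧ g ^ f * r = s / t)
  · refine W_bound hg hd M n hM hnM hcard hinj S1 S2 (fun k hk => (hS1 k hk).1) (fun k hk => (hS2 k hk).1)
      (NN d T1) (NN d T2) (fun t ht => NN_ne hd ne1 ht) R1 R2 ?_
    intro z hz
    obtain ⟨i, hi, q, ⟨s, t, hs, ht, rfl⟩, h⟩ := gap M hgen
      (fun r => ∃ s t, NN d T2 s ∧ NN d T1 t ∧ r = s / t) (s0 / t0) ⟨s0, t0, hs0, ht0, rfl⟩
      (div_ne_zero (NN_ne hd ne2 hs0) (NN_ne hd ne1 ht0)) hq z hz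
    exact ⟨i, hi, s, t, hs, ht, h⟩
  · push Not at hq
    obtain ⟨r, ⟨s, t, hs, ht, rfl⟩, hno⟩ := hq
    exact final hg hd M n hM S1 S2 T1 T2 hS1 hS2 hsep hT1 hT2 hc1 hc2 s t (NN_ne hd ne2 hs)
      (NN_ne hd ne1 ht) (R1 t ht) (R2 s hs) hno
end

lemma split_set (n : ℕ) : ∀ s : Finset ℕ, 2 * n ≤ s.card → ∃ s1 ⊆ s, ∃ s2 ⊆ s, s1.card = n ∧ s2.card = n ∧
    ∀ a ∈ s1, ∀ b ∈ s2, a < b := by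
  intro s hs
  have hstep : ∀ m, (s.filter (· < m + 1)).card ≤ (s.filter (· < m)).card + 1 := by
    intro m
    refine le_trans (card_le_card (t := insert m (s.filter (· < m))) ?_) (card_insert_le _ _)
    intro x hx
    simp only [mem_filter, mem_insert] at hx ⊢
    rcases hx with ⟨h1, h2⟩
    by_cases h : x = m
    · exact Or.inl h
    · exact Or.inr ⟨h1, by omega⟩
  have hex : ∃ m, (s.filter (· < m)).card = n := by
    have hall : ∃ m, n ≤ (s.filter (· < m)).card := by
      refine ⟨s.sup id + 1, ?_⟩
      rw [filter_true_of_mem]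
      · omega
      · intro x hx
        exact Nat.lt_succ_of_le (le_sup (f := id) hx)
    classical
    refine ⟨Nat.find hall, le_antisymm ?_ (Nat.find_spec hall)⟩
    rcases h : Nat.find hall with _ | m
    · simp
    · have := Nat.find_min hall (m := m) (by omega)
      have := hstep m
      omega
  obtain ⟨m, hm⟩ := hex
  have h2 := card_filter_add_card_filter_not (s := s) (· < m)
  obtain ⟨s2, hs2, hc⟩ := exists_subset_card_eq (s := s.filter (fun x => ¬ x < m)) (n := n) (by omega)
  refine ⟨_, filter_subset _ _, s2, hs2.trans (filter_subset _ _), hm, hc, ?_⟩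
  intro a ha b hb
  have := (mem_filter.1 ha).2
  have := (mem_filter.1 (hs2 hb)).2
  omega

section
variable {F : Type*} [Field F] [DecidableEq F]

lemma rep_bound [Fintype F] {g d : F} (hg : g ≠ 0) (hd : d ≠ 0) (M : ℕ) (hM : 1 ≤ M)
    (hcard : M ^ 2 + 1 ≤ Fintype.card F)
    (hinj : ∀ i j : ℕ, i ≤ M → j ≤ M → g ^ i = g ^ j → i = j)
    (hgen : ∀ z : F, z ≠ 0 → ∃ m : ℕ, g ^ m = z) :
    ∃ n : ℕ, n ^ 12 ≤ 10 ^ 16 * M ^ 11 ∧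
      ((Icc 1 M ×ˢ Icc 1 M).filter (fun z => g ^ z.1 - g ^ z.2 = d)).card ≤ 2 * n + 1 := by
  set R := (Icc 1 M ×ˢ Icc 1 M).filter (fun z => g ^ z.1 - g ^ z.2 = d) with hR
  set E := R.image Prod.snd with hE
  have hRE : E.card = R.card := by
    refine card_image_of_injOn ?_
    rintro ⟨x, y⟩ h ⟨x', y'⟩ h' e
    simp only [hR, mem_coe, mem_filter, mem_product, mem_Icc] at h h' e
    subst e
    have := hinj x x' h.1.1.2 h'.1.1.2 (by linear_combination h.2 - h'.2)
    rw [this]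
  have hEM : ∀ y ∈ E, 1 ≤ y ∧ y ≤ M ∧ ∃ x ≤ M, g ^ x - g ^ y = d := by
    intro y hy
    obtain ⟨⟨x, y'⟩, h, rfl⟩ := mem_image.1 hy
    simp only [hR, mem_filter, mem_product, mem_Icc] at h
    exact ⟨h.1.2.1, h.1.2.2, x, h.1.1.2, h.2⟩
  refine ⟨E.card / 2, ?_, by omega⟩
  set n := E.card / 2 with hn
  obtain ⟨E1, hE1, E2, hE2, c1, c2, hlt⟩ := split_set n E (by omega)
  have hnM : n ≤ M := by
    have : E ⊆ Icc 1 M := fun y hy => mem_Icc.2 ⟨(hEM y hy).1, (hEM y hy).2.1⟩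
    have := card_le_card this
    rw [Nat.card_Icc] at this
    omega
  have hcI : ∀ E' ⊆ E, (E'.image (fun y => (g ^ y)⁻¹)).card = E'.card := by
    intro E' h'
    refine card_image_of_injOn ?_
    intro y hy y' hy' e
    exact hinj _ _ (hEM _ (h' hy)).2.1 (hEM _ (h' hy')).2.1 (inv_injective e)
  have hP : ∀ E' ⊆ E, ∀ k ∈ E'.image (fun y => (g ^ y)⁻¹), k ∈ GP g M ∧ 1 + d * k ∈ GP g M := by
    intro E' h' k hk
    obtain ⟨y, hy, rfl⟩ := mem_image.1 hk
    obtain ⟨h1, h2, x, hx, h3⟩ := hEM _ (h' hy)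
    have : g ^ y ≠ 0 := pow_ne_zero _ hg
    refine ⟨(mem_AP _ _ _).2 ⟨-(y:ℤ), by omega, by simp⟩, (mem_AP _ _ _).2 ⟨(x:ℤ) - y, by omega, ?_⟩⟩
    rw [zpow_sub₀ hg, ← h3, zpow_natCast, zpow_natCast]
    field_simp
    ring
  refine two_sets hg hd M n hM hnM hcard hinj hgen _ _ (hP E1 hE1) (hP E2 hE2) ?_
    ((hcI _ hE1).trans c1) ((hcI _ hE2).trans c2)
  intro k hk k' hk'
  obtain ⟨y, hy, rfl⟩ := mem_image.1 hk
  obtain ⟨y', hy', rfl⟩ := mem_image.1 hk'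
  have hl := hlt _ hy _ hy'
  have := (hEM _ (hE2 hy')).2.1
  refine ⟨y' - y, by omega, by omega, ?_⟩
  obtain ⟨j, rfl⟩ := Nat.exists_eq_add_of_lt hl
  have e : y + j + 1 - y = j + 1 := by omega
  have : g ^ y ≠ 0 := pow_ne_zero _ hg
  have : g ^ (j + 1) ≠ 0 := pow_ne_zero _ hg
  simp only [e]
  rw [add_assoc, pow_add]
  field_simp
  ring

lemma energy_bound_s15 {g : F} (M B : ℕ)
    (hinj : ∀ i j : ℕ, i ≤ M → j ≤ M → g ^ i = g ^ j → i = j)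
    (hB : ∀ d : F, d ≠ 0 → ((Icc 1 M ×ˢ Icc 1 M).filter (fun z => g ^ z.1 - g ^ z.2 = d)).card ≤ B) :
    ((Icc 1 M ×ˢ Icc 1 M ×ˢ Icc 1 M ×ˢ Icc 1 M).filter
      (fun q => g ^ q.1 + g ^ q.2.1 = g ^ q.2.2.1 + g ^ q.2.2.2)).card ≤ M ^ 2 + B * M ^ 2 := by
  set X := (Icc 1 M ×ˢ Icc 1 M ×ˢ Icc 1 M ×ˢ Icc 1 M).filter
      (fun q => g ^ q.1 + g ^ q.2.1 = g ^ q.2.2.1 + g ^ q.2.2.2) with hX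
  rw [← card_filter_add_card_filter_not (s := X) (fun q => q.1 = q.2.2.1)]
  refine Nat.add_le_add ?_ ?_
  · have : (Icc 1 M ×ˢ Icc 1 M).card = M ^ 2 := by simp [card_product, sq]
    rw [← this]
    refine card_le_card_of_injOn (fun q => (q.1, q.2.1)) ?_ ?_
    · rintro ⟨x, y, z, w⟩ h
      simp only [hX, mem_coe, mem_filter, mem_product] at h ⊢
      exact ⟨h.1.1.1, h.1.1.2.1⟩
    · rintro ⟨x, y, z, w⟩ h ⟨x', y', z', w'⟩ h' e
      simp only [hX, mem_coe, mem_filter, mem_product, mem_Icc] at h h'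
      simp only [Prod.mk.injEq] at e
      obtain ⟨⟨⟨a1, a2, a3, a4⟩, a5⟩, a6⟩ := h
      obtain ⟨⟨⟨b1, b2, b3, b4⟩, b5⟩, b6⟩ := h'
      obtain ⟨rfl, rfl⟩ := e
      subst a6 b6
      have := hinj w w' a4.2 b4.2 (by linear_combination b5 - a5)
      rw [this]
  · have hc : (Icc 1 M ×ˢ Icc 1 M).card = M ^ 2 := by simp [card_product, sq]
    rw [← hc]
    refine card_le_mul_card_image_of_maps_to (f := fun q : ℕ × ℕ × ℕ × ℕ => (q.1, q.2.2.1)) ?_ B ?_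
    · rintro ⟨x, y, z, w⟩ h
      simp only [hX, mem_filter, mem_product] at h ⊢
      exact ⟨h.1.1.1, h.1.1.2.2.1⟩
    · rintro ⟨x, z⟩ hxz
      simp only [mem_product, mem_Icc] at hxz
      by_cases hne : x = z
      · convert Nat.zero_le B
        rw [card_eq_zero, filter_eq_empty_iff]
        rintro ⟨x', y, z', w⟩ h e
        simp only [hX, mem_filter, Prod.mk.injEq] at h e
        exact h.2 (by omega)
      · refine le_trans ?_ (hB (g ^ x - g ^ z) (fun h0 => hne (hinj _ _ hxz.1.2 hxz.2.2 (sub_eq_zero.1 h0))))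
        refine card_le_card_of_injOn (fun q => (q.2.2.2, q.2.1)) ?_ ?_
        · rintro ⟨x', y, z', w⟩ h
          simp only [hX, mem_coe, mem_filter, mem_product, Prod.mk.injEq] at h ⊢
          obtain ⟨⟨⟨⟨h1, h2, h3, h4⟩, h5⟩, h6⟩, rfl, rfl⟩ := h
          exact ⟨⟨h4, h2⟩, by linear_combination -h5⟩
        · rintro ⟨x', y, z', w⟩ h ⟨x'', y', z'', w'⟩ h' e
          simp only [mem_coe, mem_filter, Prod.mk.injEq] at h h' e ⊢
          obtain ⟨-, rfl, rfl⟩ := h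
          obtain ⟨-, rfl, rfl⟩ := h'
          exact ⟨rfl, e.2, rfl, e.1⟩
end

lemma energy_real (p : ℕ) [Fact p.Prime] (g : ZMod p) (hgp : IsPrimitiveRoot g (p - 1)) (M : ℕ)
    (hM : 1 < M) (hMp : M ^ 2 + 1 ≤ p) :
    (((Finset.Icc 1 M ×ˢ Finset.Icc 1 M ×ˢ Finset.Icc 1 M ×ˢ Finset.Icc 1 M).filter
              (fun q => g ^ q.1 + g ^ q.2.1 = g ^ q.2.2.1 + g ^ q.2.2.2)).card : ℝ)
            ≤ 100 * (M : ℝ) ^ (3 - 1 / 12 : ℝ) := by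
  have hp1 : M < p - 1 := by
    have : M * 2 ≤ M ^ 2 := by rw [sq]; exact Nat.mul_le_mul_left _ hM
    omega
  have hg : g ≠ 0 := hgp.ne_zero (by omega)
  have hinj : ∀ i j : ℕ, i ≤ M → j ≤ M → g ^ i = g ^ j → i = j := fun i j hi hj h =>
    hgp.pow_inj (by omega) (by omega) h
  have hgen : ∀ z : ZMod p, z ≠ 0 → ∃ m : ℕ, g ^ m = z := by
    intro z hz
    haveI : NeZero (p - 1) := ⟨by omega⟩
    obtain ⟨i, -, hi⟩ := hgp.eq_pow_of_pow_eq_one (ZMod.pow_card_sub_one_eq_one hz)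
    exact ⟨i, hi⟩
  have hcard : M ^ 2 + 1 ≤ Fintype.card (ZMod p) := by rwa [ZMod.card]
  have hM0 : (0:ℝ) ≤ M := by positivity
  have hM1 : (1:ℝ) ≤ M := by exact_mod_cast hM.le
  set x : ℝ := (M:ℝ) ^ (11 / 12 : ℝ) with hx
  have hx0 : 0 ≤ x := by positivity
  have hx1 : 1 ≤ x := Real.one_le_rpow hM1 (by norm_num)
  have hx12 : x ^ 12 = (M:ℝ) ^ 11 := by
    rw [hx, ← Real.rpow_natCast, ← Real.rpow_mul hM0, ← Real.rpow_natCast]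
    norm_num
  have hn : ∀ n : ℕ, n ^ 12 ≤ 10 ^ 16 * M ^ 11 → n ≤ ⌊22 * x⌋₊ := by
    intro n hn
    refine Nat.le_floor ?_
    have h' : (n:ℝ) ^ 12 ≤ 10 ^ 16 * (M:ℝ) ^ 11 := by exact_mod_cast hn
    refine le_of_pow_le_pow_left₀ (n := 12) (by norm_num) (by positivity) (h'.trans ?_)
    rw [mul_pow, hx12]
    exact mul_le_mul_of_nonneg_right (by norm_num) (by positivity)
  have hE := energy_bound_s15 (g := g) M (2 * ⌊22 * x⌋₊ + 1) hinj (by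
    intro d hd
    obtain ⟨n, h1, h2⟩ := rep_bound hg hd M hM.le hcard hinj hgen
    have := hn n h1
    omega)
  have hfl : (⌊22 * x⌋₊ : ℝ) ≤ 22 * x := Nat.floor_le (by positivity)
  have hpow : (M : ℝ) ^ (3 - 1 / 12 : ℝ) = (M:ℝ) ^ 2 * x := by
    rw [hx, ← Real.rpow_natCast, ← Real.rpow_add (by positivity)]
    norm_num
  have hE' : (((Finset.Icc 1 M ×ˢ Finset.Icc 1 M ×ˢ Finset.Icc 1 M ×ˢ Finset.Icc 1 M).filter
              (fun q => g ^ q.1 + g ^ q.2.1 = g ^ q.2.2.1 + g ^ q.2.2.2)).card : ℝ) ≤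
      (M:ℝ) ^ 2 + (2 * ⌊22 * x⌋₊ + 1) * (M:ℝ) ^ 2 := by exact_mod_cast hE
  rw [hpow]
  have : (0:ℝ) ≤ (M:ℝ) ^ 2 := by positivity
  nlinarith

/-- **Bourgain–Garaev additive energy bound for powers of a primitive root.**
For every `δ > 0` there is `C = C(δ) > 0` such that for every prime `p`, every
primitive root `g` modulo `p` and every integer `M` with `1 < M < p^{1/2}`, the
number of quadruples `(x, y, z, w) ∈ {1, …, M}⁴` with
`g^x + g^y ≡ g^z + g^w (mod p)` is at most `C·M^{3 − 1/24 + δ}`. -/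
theorem stmt_15 (δ : ℝ) (hδ : 0 < δ) :
    ∃ C : ℝ, 0 < C ∧
      ∀ p : ℕ, p.Prime → ∀ g : ℕ, IsPrimitiveRoot (g : ZMod p) (p - 1) →
        ∀ M : ℕ, 1 < M → (M : ℝ) < (p : ℝ) ^ ((1 : ℝ) / 2) →
          (((Finset.Icc 1 M ×ˢ Finset.Icc 1 M ×ˢ Finset.Icc 1 M ×ˢ Finset.Icc 1 M).filter
              (fun q => (g : ZMod p) ^ q.1 + (g : ZMod p) ^ q.2.1 =
                (g : ZMod p) ^ q.2.2.1 + (g : ZMod p) ^ q.2.2.2)).card : ℝ)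
            ≤ C * (M : ℝ) ^ (3 - 1 / 24 + δ) := by
  refine ⟨100, by norm_num, ?_⟩
  intro p hp g hgp M hM hMp
  haveI : Fact p.Prime := ⟨hp⟩
  have hM2 : M ^ 2 + 1 ≤ p := by
    have h1 : ((M:ℝ)) ^ 2 < ((p : ℝ) ^ ((1 : ℝ) / 2)) ^ 2 :=
      pow_lt_pow_left₀ hMp (by positivity) (by norm_num)
    have h2 : ((p : ℝ) ^ ((1 : ℝ) / 2)) ^ 2 = p := by
      rw [← Real.sqrt_eq_rpow, Real.sq_sqrt (by positivity)]
    rw [h2] at h1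
    have : M ^ 2 < p := by exact_mod_cast h1
    omega
  have h := energy_real p (g : ZMod p) hgp M hM hM2
  have hM1 : (1:ℝ) ≤ M := by exact_mod_cast hM.le
  have h3 : (M : ℝ) ^ (3 - 1 / 12 : ℝ) ≤ (M : ℝ) ^ (3 - 1 / 24 + δ) :=
    Real.rpow_le_rpow_of_exponent_le hM1 (by linarith)
  have h4 : 100 * (M : ℝ) ^ (3 - 1 / 12 : ℝ) ≤ 100 * (M : ℝ) ^ (3 - 1 / 24 + δ) := by linarith
  refine le_trans ?_ h4
  convert h
end
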